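/- arXiv:math/0106229 — 2 statements merged into one kernel-verified Lean document; each statement's English description precedes it below -/
import Mathlib

section
/- Let P be a simple lattice multi-polytope of dimension n over a complete simplicial multi-fan Δ in a lattice N of rank n. Then the Ehrhart counting functions ♯(νP) and ♯(νP°) are polynomials in the positive integer ν of degree at most n, and they satisfy the reciprocity ♯(νP°) = (−1)^n ♯(−νP) for every integer ν. -/
open Finset

/-- The pairing between a covector and a vector in `ℝⁿ`. -/
def dotp {n : ℕ} (x y : Fin n → ℝ) : ℝ := ∑ k, x k * y k

/-- A (simplicial) multi-fan of dimension `n` with rays indexed by `{1,…,d}`: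
an augmented simplicial set `S`, ray vectors `v i` spanning the simplicial cones
`C(I) = pos span {v i : i ∈ I}`, and a weight `w` on simplices (the difference
`w = w⁺ − w⁻` of the two weight functions, restricted to top simplices is what matters). -/
structure MultiFan (n d : ℕ) where
  S : Finset (Finset (Fin d))
  empty_mem : ∅ ∈ S
  downClosed : ∀ I ∈ S, ∀ J ⊆ I, J ∈ S
  card_le : ∀ I ∈ S, I.card ≤ n
  v : Fin d → (Fin n → ℝ)
  indep : ∀ I ∈ S, LinearIndependent ℝ (fun i : {x // x ∈ I} => v i.1)
  w : Finset (Fin d) → ℤ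

namespace MultiFan

variable {n d : ℕ}

/-- `x` is generic for the projected multi-fan `Δ_K`: it avoids every linear subspace
spanned by a cone (containing `C(K)`) of dimension `< n`. -/
def GenericFor (Δ : MultiFan n d) (K : Finset (Fin d)) (x : Fin n → ℝ) : Prop :=
  ∀ L ∈ Δ.S, K ⊆ L → L.card < n → x ∉ Submodule.span ℝ (Δ.v '' (L : Set (Fin d)))

def Generic (Δ : MultiFan n d) (x : Fin n → ℝ) : Prop := Δ.GenericFor ∅ x

/-- `x` lies (mod the span of `C(K)`) in the projected cone `C_K(I)`. -/
def InProjCone (Δ : MultiFan n d) (K I : Finset (Fin d)) (x : Fin n → ℝ) : Prop :=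
  ∃ a : Fin d → ℝ, (∀ j ∈ I \ K, 0 ≤ a j) ∧
    (x - ∑ j ∈ I \ K, a j • Δ.v j) ∈ Submodule.span ℝ (Δ.v '' (K : Set (Fin d)))

open scoped Classical in
/-- `d_x` for the projected multi-fan `Δ_K`: the sum of the weights of top cones whose
projection contains the projection of `x`. -/
noncomputable def dv (Δ : MultiFan n d) (K : Finset (Fin d)) (x : Fin n → ℝ) : ℤ :=
  ∑ I ∈ Δ.S.filter (fun I => I.card = n ∧ K ⊆ I ∧ Δ.InProjCone K I x), Δ.w I

/-- Pre-completeness of the projected multi-fan `Δ_K`. -/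
def PreCompleteAt (Δ : MultiFan n d) (K : Finset (Fin d)) : Prop :=
  (∃ I ∈ Δ.S, K ⊆ I ∧ I.card = n) ∧
  ∀ x y : Fin n → ℝ, Δ.GenericFor K x → Δ.GenericFor K y → Δ.dv K x = Δ.dv K y

/-- Completeness: every projected multi-fan is pre-complete. -/
def Complete (Δ : MultiFan n d) : Prop := ∀ K ∈ Δ.S, Δ.PreCompleteAt K

open scoped Classical in
/-- The Duistermaat–Heckman function of the simple multi-polytope `(Δ, {F_i})`, where
`F_i = {u : ⟨u, v i⟩ = c i}`, the data `uu I i = u_i^I` is the dual basis of `{v i : i ∈ I}`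
and `ξ ∈ V` is a generic vector.  For `I ∈ Σ^{(n)}` the coefficient of `u − u_I` on `u_i^I`
is `⟨u, v i⟩ − c i`, so membership in the cone `C^*(I)^+` is expressed by the conditions below. -/
noncomputable def DH (Δ : MultiFan n d) (c : Fin d → ℝ)
    (uu : Finset (Fin d) → Fin d → (Fin n → ℝ)) (ξ : Fin n → ℝ) (u : Fin n → ℝ) : ℤ :=
  ∑ I ∈ Δ.S.filter (fun I => I.card = n),
    if (∀ i ∈ I, (0 < dotp (uu I i) ξ ∧ c i ≤ dotp u (Δ.v i)) ∨
                 (dotp (uu I i) ξ < 0 ∧ dotp u (Δ.v i) ≤ c i))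
    then (-1 : ℤ) ^ (I.filter fun i => 0 < dotp (uu I i) ξ).card * Δ.w I
    else 0

/-- `uu I i = u_i^I` is the basis dual to `{v i : i ∈ I}` for each top simplex `I`. -/
def DualBasis (Δ : MultiFan n d) (uu : Finset (Fin d) → Fin d → (Fin n → ℝ)) : Prop :=
  ∀ I ∈ Δ.S, I.card = n → ∀ i ∈ I, ∀ j ∈ I,
    dotp (uu I i) (Δ.v j) = if i = j then 1 else 0

/-- Genericity of `ξ` needed for the DH function: `⟨u_i^I, ξ⟩ ≠ 0` for all `I, i`. -/
def GenericDual (Δ : MultiFan n d) (uu : Finset (Fin d) → Fin d → (Fin n → ℝ))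
    (ξ : Fin n → ℝ) : Prop :=
  ∀ I ∈ Δ.S, I.card = n → ∀ i ∈ I, dotp (uu I i) ξ ≠ 0

end MultiFan

/-- A (simplicial) multi-fan in the lattice `N = ℤⁿ`: the ray vectors `v i` are the
primitive integral generators of the one-dimensional cones. -/
structure LMultiFan (n d : ℕ) where
  S : Finset (Finset (Fin d))
  empty_mem : ∅ ∈ S
  downClosed : ∀ I ∈ S, ∀ J ⊆ I, J ∈ S
  card_le : ∀ I ∈ S, I.card ≤ n
  v : Fin d → (Fin n → ℤ)
  indep : ∀ I ∈ S, LinearIndependent ℝ (fun i : {x // x ∈ I} => fun k => ((v i.1 k : ℝ)))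
  w : Finset (Fin d) → ℤ

namespace LMultiFan

variable {n d : ℕ}

/-- The underlying real multi-fan. -/
def toMF (Δ : LMultiFan n d) : MultiFan n d where
  S := Δ.S
  empty_mem := Δ.empty_mem
  downClosed := Δ.downClosed
  card_le := Δ.card_le
  v := fun i k => (Δ.v i k : ℝ)
  indep := Δ.indep
  w := Δ.w

/-- The vertices `u_I = ∑_{i∈I} c_i u_i^I` of the multi-polytope with constants `c` all lie
in the lattice `N^* = ℤⁿ`, i.e. the multi-polytope is a lattice multi-polytope. -/
def LatticeVertices (Δ : LMultiFan n d) (c : Fin d → ℝ)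
    (uu : Finset (Fin d) → Fin d → (Fin n → ℝ)) : Prop :=
  ∀ I ∈ Δ.S, I.card = n → ∀ k : Fin n, ∃ m : ℤ, (∑ i ∈ I, c i * uu I i k) = (m : ℝ)

/-- `♯(P) = ∑_{u ∈ N^*} DH_{P_+}(u)`, where `P_+` is the small outward enlargement of the
lattice multi-polytope `P` (each hyperplane `⟨·, v_i⟩ = c_i` is moved in the direction of
`v_i`; since all `c_i` are integers, moving by `1/2` realizes the small enlargement). -/
noncomputable def sharpP (Δ : LMultiFan n d) (c : Fin d → ℝ)
    (uu : Finset (Fin d) → Fin d → (Fin n → ℝ)) (ξ : Fin n → ℝ) : ℤ :=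
  ∑ᶠ u : Fin n → ℤ, Δ.toMF.DH (fun i => c i + 1/2) uu ξ (fun k => (u k : ℝ))

/-- `♯(P°) = ∑_{u ∈ N^*} DH_{P_−}(u)`, with `P_−` the small inward shrinking of `P`. -/
noncomputable def sharpInt (Δ : LMultiFan n d) (c : Fin d → ℝ)
    (uu : Finset (Fin d) → Fin d → (Fin n → ℝ)) (ξ : Fin n → ℝ) : ℤ :=
  ∑ᶠ u : Fin n → ℤ, Δ.toMF.DH (fun i => c i - 1/2) uu ξ (fun k => (u k : ℝ))

end LMultiFan


namespace EhrAux

open Function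

/-- support meets every lower half space in a finite set -/
def DownFin {n : ℕ} (h : (Fin n → ℤ) →+ ℤ) (f : (Fin n → ℤ) → ℚ) : Prop :=
  ∀ R : ℤ, {u | f u ≠ 0 ∧ h u ≤ R}.Finite

lemma DownFin.shift {n : ℕ} {h : (Fin n → ℤ) →+ ℤ} {f : (Fin n → ℤ) → ℚ}
    (hf : DownFin h f) (b : Fin n → ℤ) : DownFin h (fun u => f (u - b)) := by
  intro R
  refine ((hf (R - h b)).image (fun u => u + b)).subset ?_
  rintro u ⟨h1, h2⟩
  refine ⟨u - b, ⟨h1, ?_⟩, by simp⟩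
  rw [map_sub]; linarith

lemma DownFin.sub {n : ℕ} {h : (Fin n → ℤ) →+ ℤ} {f g : (Fin n → ℤ) → ℚ}
    (hf : DownFin h f) (hg : DownFin h g) : DownFin h (fun u => f u - g u) := by
  intro R
  refine ((hf R).union (hg R)).subset ?_
  rintro u ⟨h1, h2⟩
  by_cases h3 : f u = 0
  · right
    refine ⟨fun h4 => h1 ?_, h2⟩
    simp [h3, h4]
  · left; exact ⟨h3, h2⟩

lemma DownFin.finSupp {n : ℕ} {h : (Fin n → ℤ) →+ ℤ} {f : (Fin n → ℤ) → ℚ}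
    (hf : DownFin h f) (P : ℤ → ℚ) (R : ℤ) (hP : ∀ s, R < s → P s = 0) :
    HasFiniteSupport (fun u => f u * P (h u)) := by
  refine (hf R).subset ?_
  intro u hu
  rw [mem_support] at hu
  refine ⟨left_ne_zero_of_mul hu, ?_⟩
  by_contra hc
  exact right_ne_zero_of_mul hu (hP _ (not_le.mp hc))

lemma abel {n : ℕ} {h : (Fin n → ℤ) →+ ℤ} {f : (Fin n → ℤ) → ℚ}
    (hf : DownFin h f) (P : ℤ → ℚ) (R : ℤ) (hP : ∀ s, R < s → P s = 0)
    (b : Fin n → ℤ) (M : ℤ) (hM : 0 ≤ M) (hb : h b = M) :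
    ∑ᶠ u, (f (u - b) - f u) * P (h u) = ∑ᶠ u, f u * (fwdDiff M P) (h u) := by
  have hP' : ∀ s, R < s → P (s + M) = 0 := fun s hs => hP _ (by linarith)
  have e1 : ∑ᶠ u, f (u - b) * P (h u) = ∑ᶠ u, f u * P (h u + M) := by
    rw [← finsum_comp_equiv (Equiv.addRight b)]
    simp [hb]
  simp only [sub_mul, fwdDiff, mul_sub]
  rw [finsum_sub_distrib ((hf.shift b).finSupp P R hP) (hf.finSupp P R hP), e1,
    finsum_sub_distrib (hf.finSupp (fun s => P (s + M)) R hP') (hf.finSupp P R hP)]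

/-- The cone function with the factors in `J` differenced. -/
def coneF {n d : ℕ} (y : Fin d → (Fin n → ℤ) →+ ℤ) (χ : Fin d → ℤ → ℚ) (N : Fin d → ℤ)
    (I J : Finset (Fin d)) (u : Fin n → ℤ) : ℚ :=
  (∏ i ∈ J, (χ i (y i u - N i) - χ i (y i u))) * ∏ i ∈ I \ J, χ i (y i u)

lemma coneF_insert {n d : ℕ} (y : Fin d → (Fin n → ℤ) →+ ℤ) (χ : Fin d → ℤ → ℚ) (N : Fin d → ℤ)
    (b : Fin d → (Fin n → ℤ)) (I : Finset (Fin d))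
    (hb : ∀ i ∈ I, ∀ j ∈ I, y j (b i) = if i = j then N i else 0)
    (J : Finset (Fin d)) (i : Fin d) (hi : i ∉ J) (hJ : insert i J ⊆ I) (u : Fin n → ℤ) :
    coneF y χ N I (insert i J) u = coneF y χ N I J (u - b i) - coneF y χ N I J u := by
  have hiI : i ∈ I := hJ (mem_insert_self _ _)
  have hJI : J ⊆ I := fun j hj => hJ (mem_insert_of_mem hj)
  have hs : I \ J = insert i (I \ insert i J) := by
    ext j; simp only [mem_sdiff, mem_insert]
    by_cases hj : j = i
    · subst hj; simp [hiI, hi]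
    · simp [hj]
  have hn : i ∉ I \ insert i J := by simp
  have hy : ∀ j ∈ I, j ≠ i → y j (u - b i) = y j u := by
    intro j hj hji
    rw [map_sub, hb i hiI j hj, if_neg (Ne.symm hji), sub_zero]
  have hyi : y i (u - b i) = y i u - N i := by
    rw [map_sub, hb i hiI i hiI, if_pos rfl]
  unfold coneF
  rw [hs, prod_insert hi, prod_insert hn, prod_insert hn, hyi]
  have e1 : ∏ j ∈ J, (χ j (y j (u - b i) - N j) - χ j (y j (u - b i)))
      = ∏ j ∈ J, (χ j (y j u - N j) - χ j (y j u)) := by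
    refine prod_congr rfl fun j hj => ?_
    rw [hy j (hJI hj) (fun h => hi (h ▸ hj))]
  have e2 : ∏ j ∈ I \ insert i J, χ j (y j (u - b i)) = ∏ j ∈ I \ insert i J, χ j (y j u) := by
    refine prod_congr rfl fun j hj => ?_
    simp only [mem_sdiff, mem_insert, not_or] at hj
    rw [hy j hj.1 hj.2.1]
  rw [e1, e2]; ring

lemma abel_iter {n d : ℕ} (h : (Fin n → ℤ) →+ ℤ)
    (y : Fin d → (Fin n → ℤ) →+ ℤ) (χ : Fin d → ℤ → ℚ) (N : Fin d → ℤ)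
    (b : Fin d → (Fin n → ℤ)) (I : Finset (Fin d))
    (hb : ∀ i ∈ I, ∀ j ∈ I, y j (b i) = if i = j then N i else 0)
    (M : ℤ) (hM : 0 ≤ M) (hbM : ∀ i ∈ I, h (b i) = M)
    (hf : DownFin h (fun u => ∏ i ∈ I, χ i (y i u))) (R : ℤ)
    (J : Finset (Fin d)) (hJ : J ⊆ I) :
    DownFin h (coneF y χ N I J) ∧ ∀ P : ℤ → ℚ, (∀ s, R < s → P s = 0) →
      ∑ᶠ u, coneF y χ N I J u * P (h u)
        = ∑ᶠ u, (∏ i ∈ I, χ i (y i u)) * ((fwdDiff M)^[J.card] P) (h u) := by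
  induction J using Finset.induction_on with
  | empty =>
    have : coneF y χ N I ∅ = fun u => ∏ i ∈ I, χ i (y i u) := by
      ext u; simp [coneF]
    rw [this]
    exact ⟨hf, fun P hP => by simp⟩
  | insert i J hi ih =>
    obtain ⟨ih1, ih2⟩ := ih (fun j hj => hJ (mem_insert_of_mem hj))
    have key : coneF y χ N I (insert i J)
        = fun u => coneF y χ N I J (u - b i) - coneF y χ N I J u := by
      ext u; exact coneF_insert y χ N b I hb J i hi hJ u
    refine ⟨?_, fun P hP => ?_⟩
    · rw [key]; exact (ih1.shift _).sub ih1
    · rw [key, abel ih1 P R hP (b i) M hM (hbM i (hJ (mem_insert_self _ _))), ih2,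
        card_insert_of_notMem hi, iterate_succ_apply]
      intro s hs
      simp [fwdDiff, hP s hs, hP (s + M) (by linarith)]

lemma fwd_trunc (n : ℕ) (M R : ℤ) (hM : 0 < M) (s : ℤ) (hs : s + n * M ≤ R) :
    ((fwdDiff M)^[n] (fun s : ℤ => if s ≤ R then ((s : ℚ)) ^ n else 0)) s
      = (M : ℚ) ^ n * n.factorial := by
  have hMq : (M : ℚ) ≠ 0 := by exact_mod_cast hM.ne'
  have h0 := congrFun (fwdDiff_iter_eq_factorial (R := ℚ) (n := n)) ((s : ℚ) / M)
  rw [fwdDiff_iter_eq_sum_shift] at h0 ⊢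
  have h1 : (M : ℚ) ^ n * n.factorial = (M : ℚ)^n * ((n.factorial : ℚ → ℚ) ((s : ℚ)/M)) := by
    simp
  rw [h1, ← h0, mul_sum]
  refine sum_congr rfl fun k hk => ?_
  have hk' : (k : ℤ) ≤ n := by
    have := mem_range.mp hk; omega
  have : s + k • M ≤ R := by
    simp only [nsmul_eq_mul]
    nlinarith
  rw [if_pos this]
  simp only [zsmul_eq_mul, nsmul_eq_mul]
  push_cast
  have e : (s : ℚ) + k * M = M * (s / M + k * 1) := by field_simp
  rw [e, mul_pow]; ring

lemma dotp_eq {n : ℕ} (x y : Fin n → ℝ) : dotp x y = dotProduct x y := rfl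

section real
variable {n d : ℕ} (Δ : MultiFan n d) (uu : Finset (Fin d) → Fin d → (Fin n → ℝ))

lemma expand (huu : Δ.DualBasis uu) (I : Finset (Fin d)) (hI : I ∈ Δ.S) (hn : I.card = n)
    (x : Fin n → ℝ) : x = ∑ i ∈ I, dotp (uu I i) x • Δ.v i := by
  have hsp := (Δ.indep I hI).span_eq_top_of_card_eq_finrank' (by simp [hn])
  have hx : x ∈ Submodule.span ℝ (Set.range fun i : {x // x ∈ I} => Δ.v i.1) := by
    rw [hsp]; trivial
  obtain ⟨a, ha⟩ := (Submodule.mem_span_range_iff_exists_fun ℝ).mp hx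
  rw [← Finset.sum_coe_sort]
  conv_lhs => rw [← ha]
  refine sum_congr rfl fun i _ => ?_
  congr 1
  rw [← ha, dotp_eq, dotProduct_sum]
  have : ∀ j : {x // x ∈ I}, uu I i.1 ⬝ᵥ (a j • Δ.v j.1) = if i = j then a j else 0 := by
    intro j
    rw [dotProduct_smul, ← dotp_eq, huu I hI hn i.1 i.2 j.1 j.2]
    by_cases h : i = j
    · simp [h]
    · have : i.1 ≠ j.1 := fun h' => h (Subtype.ext h')
      simp [h, this]
  simp [this]

lemma pairing (huu : Δ.DualBasis uu) (I : Finset (Fin d)) (hI : I ∈ Δ.S) (hn : I.card = n)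
    (u x : Fin n → ℝ) : dotp u x = ∑ i ∈ I, dotp (uu I i) x * dotp u (Δ.v i) := by
  conv_lhs => rw [expand Δ uu huu I hI hn x]
  rw [dotp_eq, dotProduct_sum]
  refine sum_congr rfl fun i _ => ?_
  rw [dotProduct_smul]; rfl

lemma generic_of (hC : Δ.Complete) (huu : Δ.DualBasis uu) (ξ : Fin n → ℝ)
    (hξ : Δ.GenericDual uu ξ) (K : Finset (Fin d)) : Δ.GenericFor K ξ := by
  intro L hL _ hLn hx
  obtain ⟨I, hI, hLI, hIn⟩ := (hC L hL).1
  obtain ⟨i, hiI, hiL⟩ : ∃ i ∈ I, i ∉ L := by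
    by_contra hc
    push Not at hc
    have := card_le_card (show I ⊆ L from hc)
    omega
  apply hξ I hI hIn i hiI
  have : ∀ z ∈ Submodule.span ℝ (Δ.v '' (L : Set (Fin d))), dotp (uu I i) z = 0 := by
    intro z hz
    induction hz using Submodule.span_induction with
    | mem z hz =>
      obtain ⟨j, hj, rfl⟩ := hz
      rw [huu I hI hIn i hiI j (hLI hj), if_neg]
      rintro rfl; exact hiL hj
    | zero => simp [dotp_eq]
    | add a b _ _ h1 h2 => rw [dotp_eq, dotProduct_add, ← dotp_eq, ← dotp_eq, h1, h2, add_zero]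
    | smul r a _ h1 => rw [dotp_eq, dotProduct_smul, ← dotp_eq, h1, smul_zero]
  exact this ξ hx

lemma inProj_iff (huu : Δ.DualBasis uu) (ξ : Fin n → ℝ) (hξ : Δ.GenericDual uu ξ)
    (I : Finset (Fin d)) (hI : I ∈ Δ.S) (hn : I.card = n) (K : Finset (Fin d)) (hK : K ⊆ I) :
    Δ.InProjCone K I ξ ↔ ∀ i ∈ I \ K, 0 < dotp (uu I i) ξ := by
  constructor
  · rintro ⟨a, ha, hx⟩ i hi
    have hiI := (mem_sdiff.mp hi).1
    have hiK := (mem_sdiff.mp hi).2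
    have key : ∀ z ∈ Submodule.span ℝ (Δ.v '' (K : Set (Fin d))), dotp (uu I i) z = 0 := by
      intro z hz
      induction hz using Submodule.span_induction with
      | mem z hz =>
        obtain ⟨j, hj, rfl⟩ := hz
        rw [huu I hI hn i hiI j (hK hj), if_neg]
        rintro rfl; exact hiK hj
      | zero => simp [dotp_eq]
      | add a b _ _ h1 h2 => rw [dotp_eq, dotProduct_add, ← dotp_eq, ← dotp_eq, h1, h2, add_zero]
      | smul r a _ h1 => rw [dotp_eq, dotProduct_smul, ← dotp_eq, h1, smul_zero]
    have h1 := key _ hx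
    rw [dotp_eq, dotProduct_sub, dotProduct_sum, sub_eq_zero] at h1
    have h2 : ∑ j ∈ I \ K, uu I i ⬝ᵥ (a j • Δ.v j) = ∑ j ∈ I \ K, if i = j then a j else 0 := by
      refine sum_congr rfl fun j hj => ?_
      rw [dotProduct_smul, ← dotp_eq, huu I hI hn i hiI j (mem_sdiff.mp hj).1]
      by_cases h : i = j <;> simp [h]
    rw [h2, sum_ite_eq, if_pos hi, ← dotp_eq] at h1
    exact lt_of_le_of_ne (h1 ▸ ha i hi) (Ne.symm (hξ I hI hn i hiI))
  · intro h
    refine ⟨fun i => dotp (uu I i) ξ, fun j hj => (h j hj).le, ?_⟩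
    have e := expand Δ uu huu I hI hn ξ
    rw [← sum_sdiff hK] at e
    have : ξ - ∑ j ∈ I \ K, dotp (uu I j) ξ • Δ.v j = ∑ j ∈ K, dotp (uu I j) ξ • Δ.v j := by
      rw [sub_eq_iff_eq_add, add_comm]; exact e
    rw [this]
    exact Submodule.sum_mem _ fun j hj => Submodule.smul_mem _ _
      (Submodule.subset_span ⟨j, hj, rfl⟩)

open scoped Classical in
lemma DH_prod (c : Fin d → ℝ) (ξ u : Fin n → ℝ) (hξ : Δ.GenericDual uu ξ)
    (hu : ∀ I ∈ Δ.S, I.card = n → ∀ i ∈ I, dotp u (Δ.v i) ≠ c i) :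
    Δ.DH c uu ξ u = ∑ I ∈ Δ.S.filter (fun I => I.card = n), Δ.w I * ∏ i ∈ I,
      ((if dotp u (Δ.v i) < c i then (1 : ℤ) else 0)
        - (if 0 < dotp (uu I i) ξ then (1 : ℤ) else 0)) := by
  unfold MultiFan.DH
  refine sum_congr rfl fun I hI => ?_
  obtain ⟨hI, hn⟩ := mem_filter.mp hI
  split_ifs with h
  · have : ∏ i ∈ I, ((if dotp u (Δ.v i) < c i then (1 : ℤ) else 0)
        - (if 0 < dotp (uu I i) ξ then (1 : ℤ) else 0))
        = ∏ i ∈ I, (if 0 < dotp (uu I i) ξ then (-1 : ℤ) else 1) := by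
      refine prod_congr rfl fun i hi => ?_
      rcases h i hi with ⟨h1, h2⟩ | ⟨h1, h2⟩
      · rw [if_pos h1, if_pos h1, if_neg (not_lt.mpr h2)]; norm_num
      · rw [if_neg h1.not_gt, if_neg h1.not_gt, if_pos (lt_of_le_of_ne h2 (hu I hI hn i hi))]
        norm_num
    rw [this, prod_ite, prod_const, prod_const, one_pow, mul_one, mul_comm]
  · push Not at h
    obtain ⟨i, hi, h1, h2⟩ := h
    rw [prod_eq_zero hi, mul_zero]
    rcases lt_or_gt_of_ne (hξ I hI hn i hi) with h3 | h3
    · rw [if_neg (not_lt.mpr (h2 h3).le), if_neg h3.not_gt, sub_self]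
    · rw [if_pos (h1 h3), if_pos h3, sub_self]

open scoped Classical in
lemma DH_dv (huu : Δ.DualBasis uu) (c : Fin d → ℝ) (ξ u : Fin n → ℝ) (hξ : Δ.GenericDual uu ξ)
    (hu : ∀ I ∈ Δ.S, I.card = n → ∀ i ∈ I, dotp u (Δ.v i) ≠ c i) :
    Δ.DH c uu ξ u = ∑ T ∈ Δ.S, ((-1) ^ (n - T.card) *
      ∏ i ∈ T, (if dotp u (Δ.v i) < c i then (1 : ℤ) else 0)) * Δ.dv T ξ := by
  rw [DH_prod Δ uu c ξ u hξ hu]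
  have e : ∀ T ∈ Δ.S, Δ.dv T ξ = ∑ I ∈ Δ.S.filter (fun I => I.card = n),
      if T ⊆ I ∧ ∀ i ∈ I \ T, 0 < dotp (uu I i) ξ then Δ.w I else 0 := by
    intro T hT
    unfold MultiFan.dv
    rw [← sum_filter, filter_filter]
    refine sum_congr (filter_congr fun I hI => ?_) fun _ _ => rfl
    constructor
    · rintro ⟨h1, h2, h3⟩
      exact ⟨h1, h2, (inProj_iff Δ uu huu ξ hξ I hI h1 T h2).mp h3⟩
    · rintro ⟨h1, h2, h3⟩
      exact ⟨h1, h2, (inProj_iff Δ uu huu ξ hξ I hI h1 T h2).mpr h3⟩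
  have e2 : ∀ T ∈ Δ.S, ((-1) ^ (n - T.card) *
      ∏ i ∈ T, (if dotp u (Δ.v i) < c i then (1 : ℤ) else 0)) * Δ.dv T ξ
      = ∑ I ∈ Δ.S.filter (fun I => I.card = n), ((-1) ^ (n - T.card) *
      ∏ i ∈ T, (if dotp u (Δ.v i) < c i then (1 : ℤ) else 0)) *
      if T ⊆ I ∧ ∀ i ∈ I \ T, 0 < dotp (uu I i) ξ then Δ.w I else 0 := by
    intro T hT
    rw [e T hT, mul_sum]
  rw [sum_congr rfl e2, sum_comm]
  refine sum_congr rfl fun I hI => ?_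
  obtain ⟨hI, hn⟩ := mem_filter.mp hI
  have hsub : I.powerset ⊆ Δ.S := fun T hT => Δ.downClosed I hI T (mem_powerset.mp hT)
  rw [← sum_subset hsub]
  · simp only [sub_eq_add_neg]
    rw [prod_add, mul_sum]
    refine sum_congr rfl fun T hT => ?_
    have hTI := mem_powerset.mp hT
    have : ∏ i ∈ I \ T, -(if 0 < dotp (uu I i) ξ then (1 : ℤ) else 0)
        = (-1) ^ (n - T.card) * if ∀ i ∈ I \ T, 0 < dotp (uu I i) ξ then (1 : ℤ) else 0 := by
      rw [prod_neg, card_sdiff_of_subset hTI, hn, prod_boole]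
      congr
    rw [this]
    by_cases hh : ∀ i ∈ I \ T, 0 < dotp (uu I i) ξ
    · rw [if_pos hh, if_pos ⟨hTI, hh⟩]; ring
    · rw [if_neg hh, if_neg (fun h => hh h.2)]; ring
  · intro T _ hT
    rw [if_neg (fun h => hT (mem_powerset.mpr h.1)), mul_zero]

lemma DH_indep (hC : Δ.Complete) (huu : Δ.DualBasis uu) (c : Fin d → ℝ) (ξ η u : Fin n → ℝ)
    (hξ : Δ.GenericDual uu ξ) (hη : Δ.GenericDual uu η)
    (hu : ∀ I ∈ Δ.S, I.card = n → ∀ i ∈ I, dotp u (Δ.v i) ≠ c i) :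
    Δ.DH c uu ξ u = Δ.DH c uu η u := by
  rw [DH_dv Δ uu huu c ξ u hξ hu, DH_dv Δ uu huu c η u hη hu]
  refine sum_congr rfl fun T hT => ?_
  rw [(hC T hT).2 ξ η (generic_of Δ uu hC huu ξ hξ T) (generic_of Δ uu hC huu η hη T)]

lemma GenericDual_neg (ξ : Fin n → ℝ) (hξ : Δ.GenericDual uu ξ) : Δ.GenericDual uu (-ξ) := by
  intro I hI hn i hi
  rw [dotp_eq, dotProduct_neg, ← dotp_eq]
  exact neg_ne_zero.mpr (hξ I hI hn i hi)

lemma DH_below (huu : Δ.DualBasis uu) (c : Fin d → ℝ) (ξ : Fin n → ℝ) :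
    ∃ C : ℝ, ∀ u, Δ.DH c uu ξ u ≠ 0 → C ≤ dotp u ξ := by
  classical
  refine ⟨-∑ I ∈ Δ.S, |∑ i ∈ I, dotp (uu I i) ξ * c i|, fun u hu => ?_⟩
  unfold MultiFan.DH at hu
  obtain ⟨I, hI, h⟩ := exists_ne_zero_of_sum_ne_zero hu
  obtain ⟨hI, hn⟩ := mem_filter.mp hI
  have h' := (ite_ne_right_iff.mp h).1
  rw [pairing Δ uu huu I hI hn u ξ]
  have h1 : ∑ i ∈ I, dotp (uu I i) ξ * c i ≤ ∑ i ∈ I, dotp (uu I i) ξ * dotp u (Δ.v i) := by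
    refine sum_le_sum fun i hi => ?_
    rcases h' i hi with ⟨a, b⟩ | ⟨a, b⟩ <;> nlinarith
  have h2 := single_le_sum (f := fun I => |∑ i ∈ I, dotp (uu I i) ξ * c i|)
    (fun I _ => abs_nonneg _) hI
  have h3 := neg_abs_le (∑ i ∈ I, dotp (uu I i) ξ * c i)
  linarith

lemma isOpen_generic : IsOpen {ξ | Δ.GenericDual uu ξ} := by
  have : {ξ | Δ.GenericDual uu ξ} = ⋂ I ∈ (Δ.S : Set (Finset (Fin d))), ⋂ (_ : I.card = n),
      ⋂ i ∈ (I : Set (Fin d)), {ξ | dotp (uu I i) ξ ≠ 0} := by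
    ext ξ; simp [MultiFan.GenericDual]
  rw [this]
  refine (Finset.finite_toSet _).isOpen_biInter fun I _ => isOpen_iInter_of_finite fun _ =>
    (Finset.finite_toSet _).isOpen_biInter fun i _ => ?_
  refine isOpen_ne_fun ?_ continuous_const
  unfold dotp
  fun_prop

lemma DH_bdd (hC : Δ.Complete) (huu : Δ.DualBasis uu) (c : Fin d → ℝ) (ξ : Fin n → ℝ)
    (hξ : Δ.GenericDual uu ξ) (k : Fin n) :
    ∃ C : ℝ, ∀ u, (∀ I ∈ Δ.S, I.card = n → ∀ i ∈ I, dotp u (Δ.v i) ≠ c i) →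
      Δ.DH c uu ξ u ≠ 0 → |u k| ≤ C := by
  obtain ⟨ε, hε, hg⟩ : ∃ ε : ℝ, 0 < ε ∧ Δ.GenericDual uu (ξ + ε • Pi.single k 1) := by
    have hcont : Continuous (fun ε : ℝ => ξ + ε • (Pi.single k 1 : Fin n → ℝ)) := by fun_prop
    have h1 : (fun ε : ℝ => ξ + ε • (Pi.single k 1 : Fin n → ℝ)) ⁻¹' {ξ | Δ.GenericDual uu ξ}
        ∈ nhds (0 : ℝ) :=
      ((isOpen_generic Δ uu).preimage hcont).mem_nhds (by simpa using hξ)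
    have h2 := Filter.inter_mem (mem_nhdsWithin_of_mem_nhds h1)
      (self_mem_nhdsWithin (s := Set.Ioi (0 : ℝ)))
    obtain ⟨ε, h3, h4⟩ := (inferInstance : (nhdsWithin (0 : ℝ) (Set.Ioi 0)).NeBot).nonempty_of_mem h2
    exact ⟨ε, h4, h3⟩
  obtain ⟨C1, h1⟩ := DH_below Δ uu huu c ξ
  obtain ⟨C2, h2⟩ := DH_below Δ uu huu c (-ξ)
  obtain ⟨C3, h3⟩ := DH_below Δ uu huu c (ξ + ε • Pi.single k 1)
  obtain ⟨C4, h4⟩ := DH_below Δ uu huu c (-(ξ + ε • Pi.single k 1))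
  refine ⟨(|C1| + |C2| + |C3| + |C4|) / ε, fun u hu hD => ?_⟩
  have i1 := h1 u hD
  have i2 := h2 u (by rwa [DH_indep Δ uu hC huu c _ ξ u (GenericDual_neg Δ uu _ hξ) hξ hu])
  have i3 := h3 u (by rwa [DH_indep Δ uu hC huu c _ ξ u hg hξ hu])
  have i4 := h4 u (by rwa [DH_indep Δ uu hC huu c _ ξ u (GenericDual_neg Δ uu _ hg) hξ hu])
  simp only [dotp_eq, dotProduct_neg, dotProduct_add, dotProduct_smul, dotProduct_single,
    smul_eq_mul, mul_one] at i1 i2 i3 i4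
  rw [le_div_iff₀ hε]
  nth_rewrite 1 [← abs_of_pos hε]
  rw [← abs_mul, abs_le]
  have := neg_abs_le C1
  have := neg_abs_le C2
  have := neg_abs_le C3
  have := neg_abs_le C4
  have := abs_nonneg C1
  have := abs_nonneg C2
  have := abs_nonneg C3
  have := abs_nonneg C4
  constructor <;> nlinarith

end real

lemma finite_of_bdd {n : ℕ} (s : Set (Fin n → ℤ)) (C : Fin n → ℝ)
    (h : ∀ u ∈ s, ∀ k, |(u k : ℝ)| ≤ C k) : s.Finite := by
  refine (Set.finite_Icc (fun k => -⌈C k⌉) (fun k => ⌈C k⌉)).subset fun u hu => ?_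
  constructor <;> intro k
  · have := (abs_le.mp (h u hu k)).1
    have h2 := Int.le_ceil (C k)
    have : (-(⌈C k⌉ : ℝ)) ≤ u k := by linarith
    exact_mod_cast this
  · have := (abs_le.mp (h u hu k)).2
    have h2 := Int.le_ceil (C k)
    have : (u k : ℝ) ≤ ⌈C k⌉ := by linarith
    exact_mod_cast this

/-- integer pairing as a homomorphism -/
def ih {n : ℕ} (a : Fin n → ℤ) : (Fin n → ℤ) →+ ℤ where
  toFun u := ∑ k, u k * a k
  map_zero' := by simp
  map_add' u v := by simp [add_mul, sum_add_distrib]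

lemma ih_apply {n : ℕ} (a u : Fin n → ℤ) : ih a u = ∑ k, u k * a k := rfl

lemma ih_cast {n : ℕ} (a u : Fin n → ℤ) :
    ((ih a u : ℤ) : ℝ) = dotp (fun k => (u k : ℝ)) (fun k => (a k : ℝ)) := by
  simp [ih_apply, dotp]

lemma fwd_vanish (M R : ℤ) (hM : 0 ≤ M) (k : ℕ) (P : ℤ → ℚ) (hP : ∀ s, R < s → P s = 0) :
    ∀ s, R < s → ((fwdDiff M)^[k] P) s = 0 := by
  induction k generalizing P with
  | zero => simpa using hP
  | succ k ihk =>
    rw [iterate_succ_apply]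
    refine ihk _ fun s hs => ?_
    simp [fwdDiff, hP s hs, hP (s + M) (by linarith)]

/-- difference of the step functions: the box function -/
def boxF {n d : ℕ} (y : Fin d → (Fin n → ℤ) →+ ℤ) (N : Fin d → ℤ) (I : Finset (Fin d))
    (x : Fin n → ℤ) : ℚ :=
  ∏ i ∈ I, ((if y i x ≤ N i then 1 else 0) - (if y i x ≤ 0 then 1 else 0))

lemma per_I {n d : ℕ} (h : (Fin n → ℤ) →+ ℤ)
    (y : Fin d → (Fin n → ℤ) →+ ℤ) (δ : Fin d → ℚ) (U : Fin n → ℤ) (N : Fin d → ℤ)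
    (b : Fin d → (Fin n → ℤ)) (I : Finset (Fin d))
    (hb : ∀ i ∈ I, ∀ j ∈ I, y j (b i) = if i = j then N i else 0)
    (M : ℤ) (hM : 0 ≤ M) (hbM : ∀ i ∈ I, h (b i) = M)
    (hf : DownFin h (fun u => ∏ i ∈ I, ((if y i u ≤ y i U then 1 else 0) - δ i))) (R : ℤ)
    (P : ℤ → ℚ) (hP : ∀ s, R < s → P s = 0) :
    ∑ᶠ u, (∏ i ∈ I, ((if y i u ≤ y i U then 1 else 0) - δ i)) * ((fwdDiff M)^[I.card] P) (h u)
      = ∑ᶠ x, boxF y N I x * P (h x + h U) := by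
  have := (abel_iter h y (fun i t => (if t ≤ y i U then 1 else 0) - δ i) N b I hb M hM hbM hf R I
    Subset.rfl).2 P hP
  rw [← this, ← finsum_comp_equiv (Equiv.addRight U)]
  refine finsum_congr fun x => ?_
  have e : ∀ i, (y i x + y i U - N i ≤ y i U) = (y i x ≤ N i) := fun i => by
    rw [eq_iff_iff]; constructor <;> intro <;> linarith
  have e' : ∀ i, (y i x + y i U ≤ y i U) = (y i x ≤ 0) := fun i => by
    rw [eq_iff_iff]; constructor <;> intro <;> linarith
  simp only [coneF, boxF, Equiv.coe_addRight, map_add, e, e', Finset.sdiff_self, sub_sub_sub_cancel_right,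
    prod_empty, mul_one]

lemma exists_int_generic {n d : ℕ} (Δ : MultiFan n d)
    (uu : Finset (Fin d) → Fin d → (Fin n → ℝ)) (ξ : Fin n → ℝ) (hξ : Δ.GenericDual uu ξ) :
    ∃ η : Fin n → ℤ, Δ.GenericDual uu (fun k => (η k : ℝ)) := by
  have hd : DenseRange (Pi.map (fun (_ : Fin n) (q : ℚ) => (q : ℝ))) :=
    DenseRange.piMap fun _ => Rat.denseRange_cast
  obtain ⟨q, hq⟩ := hd.exists_mem_open (isOpen_generic Δ uu) ⟨ξ, hξ⟩
  obtain ⟨b, hb⟩ := IsLocalization.exist_integer_multiples_of_finite (nonZeroDivisors ℤ) q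
  choose η hη using hb
  refine ⟨η, fun I hI hn i hi => ?_⟩
  have h1 := hq I hI hn i hi
  have e : (fun k => (η k : ℝ)) = ((b : ℤ) : ℝ) • (Pi.map (fun (_ : Fin n) (q : ℚ) => (q : ℝ)) q) := by
    ext k
    have h2 := hη k
    simp only [algebraMap_int_eq, eq_intCast, zsmul_eq_mul] at h2
    have h3 : ((η k : ℚ) : ℝ) = (((b : ℤ) * q k : ℚ) : ℝ) := by rw [h2]
    simpa using h3
  rw [e, dotp_eq, dotProduct_smul, ← dotp_eq, smul_eq_mul]
  refine mul_ne_zero ?_ h1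
  exact_mod_cast nonZeroDivisors.ne_zero b.2

lemma int_dual {n d : ℕ} (Δ : LMultiFan n d)
    (uu : Finset (Fin d) → Fin d → (Fin n → ℝ)) (huu : Δ.toMF.DualBasis uu)
    (I : Finset (Fin d)) (hI : I ∈ Δ.S) (hn : I.card = n) :
    ∃ D : ℤ, D ≠ 0 ∧ ∃ e : Fin d → Fin n → ℤ, ∀ i ∈ I, ∀ k, (e i k : ℝ) = D * uu I i k := by
  classical
  let E : {x // x ∈ I} ≃ Fin n := Fintype.equivFinOfCardEq (by simp [hn])
  let V : Matrix (Fin n) (Fin n) ℤ := Matrix.of fun k j => Δ.v (E.symm j).1 k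
  let W : Matrix (Fin n) (Fin n) ℝ := Matrix.of fun i k => uu I (E.symm i).1 k
  have hWV : W * V.map (Int.cast : ℤ → ℝ) = 1 := by
    ext i j
    have := huu I hI hn (E.symm i).1 (E.symm i).2 (E.symm j).1 (E.symm j).2
    rw [Matrix.mul_apply, Matrix.one_apply]
    have e : (if (E.symm i).1 = (E.symm j).1 then (1 : ℝ) else 0) = if i = j then 1 else 0 := by
      congr 1
      rw [Subtype.coe_inj, E.symm.injective.eq_iff]
    rw [← e, ← this]
    rfl
  have hdet : ((V.det : ℤ) : ℝ) = (V.map (Int.cast : ℤ → ℝ)).det := by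
    have := RingHom.map_det (Int.castRingHom ℝ) V
    simpa using this
  have hadj : (V.map (Int.cast : ℤ → ℝ)).adjugate = V.adjugate.map (Int.cast : ℤ → ℝ) := by
    have := RingHom.map_adjugate (Int.castRingHom ℝ) V
    simpa using this.symm
  refine ⟨V.det, ?_, fun i => if hi : i ∈ I then V.adjugate (E ⟨i, hi⟩) else fun _ => 0, ?_⟩
  · intro h0
    have := congrArg Matrix.det hWV
    rw [Matrix.det_mul, ← hdet, h0] at this
    simp at this
  · intro i hi k
    simp only [dif_pos hi]
    have h1 : W * (V.map (Int.cast : ℤ → ℝ) * (V.map (Int.cast : ℤ → ℝ)).adjugate)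
        = (V.map (Int.cast : ℤ → ℝ)).adjugate := by
      rw [← Matrix.mul_assoc, hWV, Matrix.one_mul]
    rw [Matrix.mul_adjugate, ← hdet, hadj, Matrix.mul_smul, Matrix.mul_one] at h1
    have h2 := congrFun (congrFun h1 (E ⟨i, hi⟩)) k
    simpa [W] using h2.symm

section lat
variable {n d : ℕ} (Δ : LMultiFan n d) (uu : Finset (Fin d) → Fin d → (Fin n → ℝ))

lemma v_cast (i : Fin d) (u : Fin n → ℤ) :
    dotp (fun k => (u k : ℝ)) (Δ.toMF.v i) = ((ih (Δ.v i) u : ℤ) : ℝ) := by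
  rw [ih_cast]; rfl

lemma finite_of_pair (huu : Δ.toMF.DualBasis uu) (I : Finset (Fin d)) (hI : I ∈ Δ.S)
    (hn : I.card = n) (s : Set (Fin n → ℤ)) (C : Fin d → ℝ)
    (h : ∀ u ∈ s, ∀ i ∈ I, |((ih (Δ.v i) u : ℤ) : ℝ)| ≤ C i) : s.Finite := by
  refine finite_of_bdd s (fun k => ∑ i ∈ I, |uu I i k| * C i) fun u hu k => ?_
  have h1 := pairing Δ.toMF uu huu I hI hn (fun k => (u k : ℝ)) (Pi.single k 1)
  rw [dotp_eq, dotProduct_single, mul_one] at h1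
  rw [h1]
  refine (abs_sum_le_sum_abs _ _).trans (sum_le_sum fun i hi => ?_)
  rw [dotp_eq, dotProduct_single, mul_one, abs_mul, v_cast]
  exact mul_le_mul_of_nonneg_left (h u hu i hi) (abs_nonneg _)

lemma box_fin (huu : Δ.toMF.DualBasis uu) (I : Finset (Fin d)) (hI : I ∈ Δ.S)
    (hn : I.card = n) (N : Fin d → ℤ) :
    (support (boxF (fun i => ih (Δ.v i)) N I)).Finite := by
  refine finite_of_pair Δ uu huu I hI hn _ (fun i => |(N i : ℝ)|) fun u hu i hi => ?_
  rw [mem_support] at hu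
  have h1 := prod_ne_zero_iff.mp hu i hi
  have h2 : |ih (Δ.v i) u| ≤ |N i| := by
    by_contra hc
    apply h1
    rw [not_le, lt_abs, abs_lt, abs_lt] at hc
    dsimp only
    split_ifs <;> first | omega | simp
  exact_mod_cast h2

lemma downFin_cone (huu : Δ.toMF.DualBasis uu) (I : Finset (Fin d)) (hI : I ∈ Δ.S)
    (hn : I.card = n) (η : Fin n → ℤ) (hη : Δ.toMF.GenericDual uu (fun k => (η k : ℝ)))
    (U : Fin n → ℤ) (δ : Fin d → ℚ)
    (hδ : ∀ i ∈ I, (0 < dotp (uu I i) (fun k => (η k : ℝ)) → δ i = 1) ∧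
      (dotp (uu I i) (fun k => (η k : ℝ)) < 0 → δ i = 0)) :
    DownFin (ih η) (fun u => ∏ i ∈ I,
      ((if ih (Δ.v i) u ≤ ih (Δ.v i) U then 1 else 0) - δ i)) := by
  intro R
  set a : Fin d → ℝ := fun i => dotp (uu I i) (fun k => (η k : ℝ)) with ha
  set γ : Fin d → ℝ := fun i => ((ih (Δ.v i) U : ℤ) : ℝ) with hγ
  refine finite_of_pair Δ uu huu I hI hn _
    (fun i => |γ i| + |(R : ℝ) - ∑ j ∈ I, a j * γ j| / |a i|) ?_
  rintro u ⟨hu, huR⟩ i hi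
  have hpos : ∀ j ∈ I, 0 ≤ a j * (((ih (Δ.v j) u : ℤ) : ℝ) - γ j) := by
    intro j hj
    have h1 := prod_ne_zero_iff.mp hu j hj
    rcases lt_or_gt_of_ne (hη I hI hn j hj) with h2 | h2
    · rw [(hδ j hj).2 h2] at h1
      have h3 : ih (Δ.v j) u ≤ ih (Δ.v j) U := by
        by_contra hc; simp [hc] at h1
      have h4 : ((ih (Δ.v j) u : ℤ) : ℝ) ≤ γ j := by simp only [hγ]; exact_mod_cast h3
      exact mul_nonneg_of_nonpos_of_nonpos h2.le (by linarith)
    · rw [(hδ j hj).1 h2] at h1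
      have h3 : ¬ ih (Δ.v j) u ≤ ih (Δ.v j) U := by
        intro hc; simp [hc] at h1
      have h4 : γ j ≤ ((ih (Δ.v j) u : ℤ) : ℝ) := by simp only [hγ]; exact_mod_cast (not_le.mp h3).le
      exact mul_nonneg h2.le (by linarith)
  have hsum : ((ih η u : ℤ) : ℝ) = ∑ j ∈ I, a j * ((ih (Δ.v j) u : ℤ) : ℝ) := by
    rw [ih_cast, pairing Δ.toMF uu huu I hI hn]
    refine sum_congr rfl fun j _ => ?_
    rw [v_cast]
  have huR' : ((ih η u : ℤ) : ℝ) ≤ R := by exact_mod_cast huR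
  have h1 := single_le_sum hpos hi
  have h2 : ∑ j ∈ I, a j * (((ih (Δ.v j) u : ℤ) : ℝ) - γ j)
      = ((ih η u : ℤ) : ℝ) - ∑ j ∈ I, a j * γ j := by
    rw [hsum, ← sum_sub_distrib]
    exact sum_congr rfl fun j _ => by ring
  rw [h2] at h1
  have hai : 0 < |a i| := abs_pos.mpr (hη I hI hn i hi)
  have h3 : |((ih (Δ.v i) u : ℤ) : ℝ) - γ i| ≤ |(R : ℝ) - ∑ j ∈ I, a j * γ j| / |a i| := by
    rw [le_div_iff₀ hai, mul_comm, ← abs_mul, abs_of_nonneg (hpos i hi)]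
    exact (h1.trans (by linarith)).trans (le_abs_self _)
  have h4 := abs_sub_abs_le_abs_sub ((ih (Δ.v i) u : ℤ) : ℝ) (γ i)
  linarith

end lat

section main
variable {n d : ℕ} (Δ : LMultiFan n d) (uu : Finset (Fin d) → Fin d → (Fin n → ℝ))

lemma vertex (huu : Δ.toMF.DualBasis uu) (c : Fin d → ℝ) (I : Finset (Fin d)) (hI : I ∈ Δ.S)
    (hn : I.card = n) (U : Fin n → ℤ) (hU : ∀ k, (∑ i ∈ I, c i * uu I i k) = (U k : ℝ))
    (i : Fin d) (hi : i ∈ I) : c i = ((ih (Δ.v i) U : ℤ) : ℝ) := by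
  rw [← v_cast]
  have : (fun k => (U k : ℝ)) = ∑ j ∈ I, c j • uu I j := by
    ext k; rw [← hU k]; simp
  rw [this, dotp_eq, sum_dotProduct]
  have e : ∀ j ∈ I, (c j • uu I j) ⬝ᵥ Δ.toMF.v i = if j = i then c j else 0 := by
    intro j hj
    rw [smul_dotProduct, ← dotp_eq, huu I hI hn j hj i hi]
    by_cases h : j = i <;> simp [h]
  rw [sum_congr rfl e, sum_ite_eq', if_pos hi]

lemma exists_int_c (huu : Δ.toMF.DualBasis uu) (c : Fin d → ℝ) (hlat : Δ.LatticeVertices c uu) :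
    ∀ I ∈ Δ.S, I.card = n → ∀ i ∈ I, ∃ m : ℤ, c i = m := by
  intro I hI hn i hi
  choose U hU using hlat I hI hn
  exact ⟨_, vertex Δ uu huu c I hI hn U hU i hi⟩

lemma offwall (huu : Δ.toMF.DualBasis uu) (c : Fin d → ℝ) (hlat : Δ.LatticeVertices c uu)
    (ν ε : ℤ) (hε : ε = 1 ∨ ε = -1) (u : Fin n → ℤ) :
    ∀ I ∈ Δ.toMF.S, I.card = n → ∀ i ∈ I,
      dotp (fun k => (u k : ℝ)) (Δ.toMF.v i) ≠ (ν : ℝ) * c i + ε * (1 / 2) := by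
  intro I hI hn i hi h
  obtain ⟨m, hm⟩ := exists_int_c Δ uu huu c hlat I hI hn i hi
  rw [v_cast, hm] at h
  have h2 : (2 * (ih (Δ.v i) u) : ℤ) = 2 * (ν * m) + ε := by
    have : ((2 * (ih (Δ.v i) u) : ℤ) : ℝ) = ((2 * (ν * m) + ε : ℤ) : ℝ) := by
      push_cast; linarith
    exact_mod_cast this
  omega

lemma sharpP_indep (hC : Δ.toMF.Complete) (huu : Δ.toMF.DualBasis uu) (c : Fin d → ℝ)
    (hlat : Δ.LatticeVertices c uu) (ξ η : Fin n → ℝ)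
    (hξ : Δ.toMF.GenericDual uu ξ) (hη : Δ.toMF.GenericDual uu η) (ν : ℤ) :
    Δ.sharpP (fun i => (ν : ℝ) * c i) uu ξ = Δ.sharpP (fun i => (ν : ℝ) * c i) uu η := by
  unfold LMultiFan.sharpP
  refine finsum_congr fun u => DH_indep Δ.toMF uu hC huu _ ξ η _ hξ hη ?_
  have := offwall Δ uu huu c hlat ν 1 (Or.inl rfl) u
  simpa using this

lemma sharpInt_eq (huu : Δ.toMF.DualBasis uu) (c : Fin d → ℝ)
    (hlat : Δ.LatticeVertices c uu) (ξ : Fin n → ℝ)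
    (hξ : Δ.toMF.GenericDual uu ξ) (ν : ℤ) :
    Δ.sharpInt (fun i => (ν : ℝ) * c i) uu ξ
      = (-1) ^ n * Δ.sharpP (fun i => ((-ν : ℤ) : ℝ) * c i) uu (-ξ) := by
  unfold LMultiFan.sharpP LMultiFan.sharpInt
  rw [mul_finsum, ← finsum_comp_equiv (Equiv.neg _)]
  refine finsum_congr fun u => ?_
  have o1 := offwall Δ uu huu c hlat ν (-1) (Or.inr rfl) (-u)
  have o2 := offwall Δ uu huu c hlat (-ν) 1 (Or.inl rfl) u
  rw [DH_prod Δ.toMF uu _ _ _ hξ (by simpa [sub_eq_add_neg] using o1),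
    DH_prod Δ.toMF uu _ _ _ (GenericDual_neg _ _ _ hξ) (by simpa using o2), mul_sum]
  refine sum_congr rfl fun I hI => ?_
  obtain ⟨hI, hn⟩ := mem_filter.mp hI
  rw [mul_left_comm]
  congr 1
  have hpow : ((-1 : ℤ)) ^ n = ∏ _i ∈ I, (-1 : ℤ) := by rw [prod_const, hn]
  rw [hpow, ← prod_mul_distrib]
  refine prod_congr rfl fun i hi => ?_
  have hne := o2 I hI hn i hi
  have hz := hξ I hI hn i hi
  have e1 : dotp (fun k => (((Equiv.neg (Fin n → ℤ)) u k : ℤ) : ℝ)) (Δ.toMF.v i)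
      = - dotp (fun k => (u k : ℝ)) (Δ.toMF.v i) := by
    simp [dotp]
  have e2 : dotp (uu I i) (-ξ) = - dotp (uu I i) ξ := by simp [dotp]
  rw [e1, e2]
  generalize dotp (fun k => (u k : ℝ)) (Δ.toMF.v i) = t at *
  generalize dotp (uu I i) ξ = a at *
  push_cast at hne ⊢
  have h1 : (-t < ν * c i - 1 / 2) ↔ ¬ (t < -ν * c i + 1 / 2) := by
    rw [not_lt]
    constructor
    · intro h; linarith
    · intro h
      have := lt_of_le_of_ne h (fun h' => hne (by linarith))
      linarith
  have h2 : (0 < a) ↔ ¬ (0 < -a) := by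
    rw [not_lt]
    constructor
    · intro h; linarith
    · intro h; exact lt_of_le_of_ne (by linarith) (Ne.symm hz)
  simp only [h1, h2]
  split_ifs <;> simp

theorem poly_main (hC : Δ.toMF.Complete)
    (c : Fin d → ℝ) (huu : Δ.toMF.DualBasis uu) (ξ : Fin n → ℝ) (hξ : Δ.toMF.GenericDual uu ξ)
    (hlat : Δ.LatticeVertices c uu) :
    ∃ p : Polynomial ℚ, p.natDegree ≤ n ∧ ∀ ξ, Δ.toMF.GenericDual uu ξ → ∀ ν : ℤ,
      (Δ.sharpP (fun i => (ν : ℝ) * c i) uu ξ : ℚ) = p.eval (ν : ℚ) := by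
  classical
  obtain ⟨η, hη⟩ := exists_int_generic Δ.toMF uu ξ hξ
  set ηr : Fin n → ℝ := fun k => (η k : ℝ) with hηr
  set T : Finset (Finset (Fin d)) := Δ.S.filter (fun I => I.card = n) with hT
  have hTS : ∀ I ∈ T, I ∈ Δ.S := fun I hI => (mem_filter.mp hI).1
  have hTn : ∀ I ∈ T, I.card = n := fun I hI => (mem_filter.mp hI).2
  have hex : ∀ I, ∃ D : ℤ, ∃ e : Fin d → Fin n → ℤ, I ∈ T →
      (D ≠ 0 ∧ ∀ i ∈ I, ∀ k, (e i k : ℝ) = D * uu I i k) := by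
    intro I
    by_cases hI : I ∈ T
    · obtain ⟨D, hD, e, he⟩ := int_dual Δ uu huu I (hTS I hI) (hTn I hI)
      exact ⟨D, e, fun _ => ⟨hD, he⟩⟩
    · exact ⟨0, 0, fun h => absurd h hI⟩
  choose D e hDe using hex
  have hexU : ∀ I, ∃ U : Fin n → ℤ, I ∈ T → ∀ k, (∑ i ∈ I, c i * uu I i k) = (U k : ℝ) := by
    intro I
    by_cases hI : I ∈ T
    · choose U hU using hlat I (hTS I hI) (hTn I hI)
      exact ⟨U, fun _ => hU⟩
    · exact ⟨0, fun h => absurd h hI⟩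
  choose U hU using hexU
  set m : Finset (Fin d) → Fin d → ℤ := fun I i => ih η (e I i) with hm
  have hdot : ∀ I ∈ T, ∀ i ∈ I, ∀ z : Fin n → ℤ, ((ih z (e I i) : ℤ) : ℝ)
      = D I * dotp (uu I i) (fun k => (z k : ℝ)) := by
    intro I hI i hi z
    rw [ih_cast]
    have : (fun k => (e I i k : ℝ)) = (D I : ℝ) • uu I i := by
      ext k; rw [(hDe I hI).2 i hi k]; simp
    rw [this, dotp_eq, smul_dotProduct, ← dotp_eq, smul_eq_mul]
  have hm0 : ∀ I ∈ T, ∀ i ∈ I, m I i ≠ 0 := by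
    intro I hI i hi h0
    have h1 := hdot I hI i hi η
    have h2 : ((ih η (e I i) : ℤ) : ℝ) = 0 := by exact_mod_cast h0
    rw [h2] at h1
    exact mul_ne_zero (by exact_mod_cast (hDe I hI).1) (hη I (hTS I hI) (hTn I hI) i hi) h1.symm
  set M : ℤ := ∏ I ∈ T, ∏ i ∈ I, |m I i| with hM
  have hMpos : 0 < M := prod_pos fun I hI => prod_pos fun i hi => abs_pos.mpr (hm0 I hI i hi)
  have hdvd : ∀ I ∈ T, ∀ i ∈ I, m I i ∣ M := fun I hI i hi =>
    ((dvd_abs _ _).mpr dvd_rfl).trans ((dvd_prod_of_mem (fun i => |m I i|) hi).trans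
      (dvd_prod_of_mem (fun I => ∏ i ∈ I, |m I i|) hI))
  set b : Finset (Fin d) → Fin d → Fin n → ℤ := fun I i => (M / m I i) • e I i with hb
  set N : Finset (Fin d) → Fin d → ℤ := fun I i => (M / m I i) * D I with hN
  set y : Fin d → (Fin n → ℤ) →+ ℤ := fun i => ih (Δ.v i) with hy
  have hyb : ∀ I ∈ T, ∀ i ∈ I, ∀ j ∈ I, y j (b I i) = if i = j then N I i else 0 := by
    intro I hI i hi j hj
    have h1 := hdot I hI i hi (Δ.v j)
    have h2 := huu I (hTS I hI) (hTn I hI) i hi j hj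
    have h2' : dotp (uu I i) (fun k => (Δ.v j k : ℝ)) = if i = j then 1 else 0 := h2
    rw [h2'] at h1
    have h3 : ih (Δ.v j) (e I i) = if i = j then D I else 0 := by
      have : ((ih (Δ.v j) (e I i) : ℤ) : ℝ) = ((if i = j then D I else 0 : ℤ) : ℝ) := by
        rw [h1]; split_ifs <;> simp
      exact_mod_cast this
    simp only [hy, hb, hN, map_zsmul, h3]
    split_ifs <;> simp
  have hhb : ∀ I ∈ T, ∀ i ∈ I, ih η (b I i) = M := by
    intro I hI i hi
    simp only [hb, map_zsmul, smul_eq_mul]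
    exact Int.ediv_mul_cancel (hdvd I hI i hi)
  have hBfin : ∀ I ∈ T, (support (boxF y (N I) I)).Finite := fun I hI =>
    box_fin Δ uu huu I (hTS I hI) (hTn I hI) (N I)
  -- the polynomial
  let B : Finset (Fin d) → Finset (Fin n → ℤ) := fun I =>
    if hI : I ∈ T then (hBfin I hI).toFinset else ∅
  have hBmem : ∀ I ∈ T, ∀ x, x ∈ B I ↔ boxF y (N I) I x ≠ 0 := by
    intro I hI x
    simp [B, dif_pos hI]
  let p0 : Polynomial ℚ := ∑ I ∈ T, ∑ x ∈ B I, Polynomial.C ((Δ.w I : ℚ) * boxF y (N I) I x) *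
      (Polynomial.C ((ih η x : ℤ) : ℚ) + Polynomial.C ((ih η (U I) : ℤ) : ℚ) * Polynomial.X) ^ n
  refine ⟨Polynomial.C (((M : ℚ) ^ n * n.factorial)⁻¹) * p0, ?_, ?_⟩
  · refine (Polynomial.natDegree_C_mul_le _ _).trans ?_
    refine Polynomial.natDegree_sum_le_of_forall_le _ _ fun I hI => ?_
    refine Polynomial.natDegree_sum_le_of_forall_le _ _ fun x hx => ?_
    refine (Polynomial.natDegree_C_mul_le _ _).trans ?_
    refine Polynomial.natDegree_pow_le.trans ?_
    have : (Polynomial.C ((ih η x : ℤ) : ℚ) +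
        Polynomial.C ((ih η (U I) : ℤ) : ℚ) * Polynomial.X).natDegree ≤ 1 := by
      compute_degree
    nlinarith
  intro ξ' hξ' ν
  rw [sharpP_indep Δ uu hC huu c hlat ξ' ηr hξ' hη ν]
  have hoff : ∀ u : Fin n → ℤ, ∀ I ∈ Δ.toMF.S, I.card = n → ∀ i ∈ I,
      dotp (fun k => (u k : ℝ)) (Δ.toMF.v i) ≠ (ν : ℝ) * c i + 1 / 2 := by
    intro u
    have := offwall Δ uu huu c hlat ν 1 (Or.inl rfl) u
    simpa using this
  set g : (Fin n → ℤ) → ℤ := fun u =>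
    Δ.toMF.DH (fun i => (ν : ℝ) * c i + 1/2) uu ηr (fun k => (u k : ℝ)) with hg
  have hgfin : (support g).Finite := by
    choose C hCb using DH_bdd Δ.toMF uu hC huu (fun i => (ν : ℝ) * c i + 1/2) ηr hη
    exact finite_of_bdd _ C fun u hu k => hCb k _ (hoff u) hu
  let δ : Finset (Fin d) → Fin d → ℚ := fun I i => if 0 < dotp (uu I i) ηr then 1 else 0
  let f : Finset (Fin d) → (Fin n → ℤ) → ℚ := fun I u =>
    ∏ i ∈ I, ((if y i u ≤ y i (ν • U I) then 1 else 0) - δ I i)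
  have hgf : ∀ u, (g u : ℚ) = ∑ I ∈ T, (Δ.w I : ℚ) * f I u := by
    intro u
    simp only [hg]
    rw [DH_prod Δ.toMF uu _ _ _ hη (hoff u)]
    push_cast
    refine sum_congr rfl fun I hI => ?_
    congr 1
    refine prod_congr rfl fun i hi => ?_
    congr 1
    rw [v_cast, vertex Δ uu huu c I (hTS I hI) (hTn I hI) (U I) (hU I hI) i hi]
    have : (((ih (Δ.v i) u : ℤ) : ℝ) < ν * ((ih (Δ.v i) (U I) : ℤ) : ℝ) + 1 / 2)
        ↔ y i u ≤ y i (ν • U I) := by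
      simp only [hy, map_zsmul, smul_eq_mul]
      constructor
      · intro h
        by_contra hc
        have h1 : ν * ih (Δ.v i) (U I) + 1 ≤ ih (Δ.v i) u := by omega
        have h2 : (ν : ℝ) * ((ih (Δ.v i) (U I) : ℤ) : ℝ) + 1 ≤ ((ih (Δ.v i) u : ℤ) : ℝ) := by
          exact_mod_cast h1
        linarith
      · intro h1
        have h2 : ((ih (Δ.v i) u : ℤ) : ℝ) ≤ (ν : ℝ) * ((ih (Δ.v i) (U I) : ℤ) : ℝ) := by
          exact_mod_cast h1
        linarith
    simp only [this]
  have hdf : ∀ I ∈ T, DownFin (ih η) (f I) := by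
    intro I hI
    refine downFin_cone Δ uu huu I (hTS I hI) (hTn I hI) η hη (ν • U I) (δ I) fun i hi => ?_
    exact ⟨fun h => if_pos h, fun h => if_neg h.not_gt⟩
  -- choose the truncation level
  obtain ⟨R, hR⟩ := Finset.exists_le (hgfin.toFinset.image (fun u => ih η u + n * M) ∪
    T.biUnion fun I => (B I).image fun x => ih η x + ih η (ν • U I))
  let P : ℤ → ℚ := fun s => if s ≤ R then (s : ℚ) ^ n else 0
  have hP : ∀ s, R < s → P s = 0 := fun s hs => if_neg (not_le.mpr hs)
  set F : ℤ → ℚ := (fwdDiff M)^[n] P with hF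
  have hFv : ∀ s, R < s → F s = 0 := fwd_vanish M R hMpos.le n P hP
  have L1 : ∑ᶠ u, (g u : ℚ) * F (ih η u) = (∑ᶠ u, (g u : ℚ)) * ((M : ℚ) ^ n * n.factorial) := by
    rw [finsum_mul]
    refine finsum_congr fun u => ?_
    by_cases hu : g u = 0
    · simp [hu]
    · congr 1
      refine fwd_trunc n M R hMpos _ (hR _ ?_)
      exact mem_union_left _ (mem_image_of_mem _ (hgfin.mem_toFinset.mpr hu))
  have L2 : ∑ᶠ u, (g u : ℚ) * F (ih η u)
      = ∑ I ∈ T, (Δ.w I : ℚ) * ∑ᶠ u, f I u * F (ih η u) := by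
    have : ∀ u, (g u : ℚ) * F (ih η u) = ∑ I ∈ T, (Δ.w I : ℚ) * (f I u * F (ih η u)) := by
      intro u
      rw [hgf, sum_mul]
      exact sum_congr rfl fun I _ => by ring
    rw [finsum_congr this, finsum_sum_comm]
    · exact sum_congr rfl fun I _ => (mul_finsum _ _).symm
    · intro I hI
      refine ((hdf I hI).finSupp F R hFv).subset ?_
      intro u hu
      rw [mem_support] at hu ⊢
      exact right_ne_zero_of_mul hu
  have L3 : ∀ I ∈ T, ∑ᶠ u, f I u * F (ih η u)
      = ∑ x ∈ B I, boxF y (N I) I x * ((ih η x : ℤ) + (ν : ℚ) * (ih η (U I) : ℤ)) ^ n := by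
    intro I hI
    have h1 := per_I (ih η) y (δ I) (ν • U I) (N I) (b I) I (hyb I hI) M hMpos.le (hhb I hI)
      (hdf I hI) R P hP
    rw [hTn I hI] at h1
    refine h1.trans ?_
    rw [finsum_eq_sum_of_support_subset (s := B I)]
    · refine sum_congr rfl fun x hx => ?_
      congr 1
      have : ih η x + ih η (ν • U I) ≤ R := hR _ (mem_union_right _
        (mem_biUnion.mpr ⟨I, hI, mem_image_of_mem _ hx⟩))
      simp only [P, if_pos this]
      rw [map_zsmul]; push_cast; simp
    · intro x hx
      rw [mem_support] at hx
      exact (hBmem I hI x).mpr (left_ne_zero_of_mul hx)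
  have L4 : ((∑ᶠ u, g u : ℤ) : ℚ) = ∑ᶠ u, (g u : ℚ) :=
    (Int.castAddHom ℚ).map_finsum hgfin
  have hne : (M : ℚ) ^ n * n.factorial ≠ 0 :=
    mul_ne_zero (pow_ne_zero _ (by exact_mod_cast hMpos.ne')) (by exact_mod_cast n.factorial_ne_zero)
  have hs : Δ.sharpP (fun i => (ν : ℝ) * c i) uu ηr = ∑ᶠ u, g u := rfl
  rw [hs, L4, Polynomial.eval_mul, Polynomial.eval_C, eq_inv_mul_iff_mul_eq₀ hne, mul_comm, ← L1, L2]
  simp only [p0, Polynomial.eval_finsetSum, Polynomial.eval_mul, Polynomial.eval_C,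
    Polynomial.eval_pow, Polynomial.eval_add, Polynomial.eval_X]
  refine sum_congr rfl fun I hI => ?_
  rw [L3 I hI, mul_sum]
  refine sum_congr rfl fun x _ => ?_
  ring

end main

end EhrAux

/-- **Theorem 7.2 (1),(2)**: for a simple lattice multi-polytope `P` of dimension `n`, the
Ehrhart counting functions `♯(νP)` and `♯(νP°)` are polynomials in `ν` of degree at most
`n`, and they satisfy the reciprocity `♯(νP°) = (−1)ⁿ ♯(−νP)` for every integer `ν`. -/
theorem stmt10 (n d : ℕ) (Δ : LMultiFan n d) (hC : Δ.toMF.Complete)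
    (c : Fin d → ℝ) (uu : Finset (Fin d) → Fin d → (Fin n → ℝ))
    (huu : Δ.toMF.DualBasis uu) (ξ : Fin n → ℝ) (hξ : Δ.toMF.GenericDual uu ξ)
    (hlat : Δ.LatticeVertices c uu) :
    ∃ p q : Polynomial ℚ, p.natDegree ≤ n ∧ q.natDegree ≤ n ∧
      (∀ ν : ℕ, 0 < ν →
        (Δ.sharpP (fun i => (ν : ℝ) * c i) uu ξ : ℚ) = p.eval (ν : ℚ) ∧
        (Δ.sharpInt (fun i => (ν : ℝ) * c i) uu ξ : ℚ) = q.eval (ν : ℚ)) ∧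
      (∀ ν : ℤ, q.eval (ν : ℚ) = (-1 : ℚ)^n * p.eval (-(ν : ℚ))) := by
  obtain ⟨p, hp, hpe⟩ := EhrAux.poly_main Δ uu hC c huu ξ hξ hlat
  refine ⟨p, Polynomial.C ((-1 : ℚ) ^ n) * p.comp (-Polynomial.X), hp, ?_, ?_, ?_⟩
  · refine (Polynomial.natDegree_C_mul_le _ _).trans ?_
    rw [Polynomial.natDegree_comp]
    simpa using hp
  · intro ν _
    have h1 := hpe ξ hξ (ν : ℤ)
    have h2 := EhrAux.sharpInt_eq Δ uu huu c hlat ξ hξ (ν : ℤ)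
    have h3 := hpe (-ξ) (EhrAux.GenericDual_neg _ _ _ hξ) (-(ν : ℤ))
    simp only [Int.cast_natCast] at h1 h2
    refine ⟨h1, ?_⟩
    rw [h2]
    push_cast at h3 ⊢
    rw [h3]
    simp
  · intro ν
    simp
end

section
/- For a simple lattice multi-polytope P of dimension n, the leading coefficient (coefficient of ν^n) of the Ehrhart polynomial ♯(νP) equals vol(P) := ∫_{V*} DH_P dV*, and the constant term ♯(0·P) equals deg(Δ). -/
open Finset

section Part1

variable {n d : ℕ}

lemma dotp_eq (x y : Fin n → ℝ) : dotp x y = x ⬝ᵥ y := rfl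

/-- Pairing with a fixed covector as a linear map. -/
noncomputable def dotpL (x : Fin n → ℝ) : (Fin n → ℝ) →ₗ[ℝ] ℝ where
  toFun y := dotp x y
  map_add' y z := by simp [dotp_eq, dotProduct_add]
  map_smul' a y := by simp [dotp_eq, dotProduct_smul]

lemma dotpL_apply (x y : Fin n → ℝ) : dotpL x y = dotp x y := rfl

lemma dotp_comm (x y : Fin n → ℝ) : dotp x y = dotp y x := by
  simp [dotp_eq, dotProduct_comm]

lemma dotp_neg_right (x y : Fin n → ℝ) : dotp x (-y) = - dotp x y := by
  simp [dotp_eq]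

namespace MultiFan

lemma expand (Δ : MultiFan n d) {uu : Finset (Fin d) → Fin d → (Fin n → ℝ)}
    (huu : Δ.DualBasis uu) {I : Finset (Fin d)} (hI : I ∈ Δ.S) (hn : I.card = n)
    (x : Fin n → ℝ) : x = ∑ i ∈ I, dotp (uu I i) x • Δ.v i := by
  have hs : Submodule.span ℝ (Set.range (fun i : {x // x ∈ I} => Δ.v i.1)) = ⊤ := by
    apply (Δ.indep I hI).span_eq_top_of_card_eq_finrank'
    simp [hn]
  have hx : x ∈ Submodule.span ℝ (Set.range (fun i : {x // x ∈ I} => Δ.v i.1)) := by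
    rw [hs]; trivial
  obtain ⟨a, ha⟩ := (Submodule.mem_span_range_iff_exists_fun ℝ).1 hx
  have key : ∀ i : {x // x ∈ I}, dotp (uu I i.1) x = a i := by
    intro i
    rw [← ha, ← dotpL_apply, map_sum]
    rw [Finset.sum_eq_single i]
    · rw [map_smul, dotpL_apply, huu I hI hn i.1 i.2 i.1 i.2]; simp
    · intro j _ hj
      rw [map_smul, dotpL_apply, huu I hI hn i.1 i.2 j.1 j.2, if_neg]
      · simp
      · intro h; exact hj (Subtype.ext h.symm)
    · simp
  rw [← Finset.sum_coe_sort I]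
  simp only [key]
  exact ha.symm

lemma dotp_expand (Δ : MultiFan n d) {uu : Finset (Fin d) → Fin d → (Fin n → ℝ)}
    (huu : Δ.DualBasis uu) {I : Finset (Fin d)} (hI : I ∈ Δ.S) (hn : I.card = n)
    (u x : Fin n → ℝ) : dotp u x = ∑ i ∈ I, dotp (uu I i) x * dotp u (Δ.v i) := by
  conv_lhs => rw [Δ.expand huu hI hn x, ← dotpL_apply, map_sum]
  simp [dotpL_apply]

lemma dotp_span_zero (Δ : MultiFan n d) {uu : Finset (Fin d) → Fin d → (Fin n → ℝ)}
    (huu : Δ.DualBasis uu) {I K : Finset (Fin d)} (hI : I ∈ Δ.S) (hn : I.card = n)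
    (hK : K ⊆ I) {i : Fin d} (hi : i ∈ I \ K) {x : Fin n → ℝ}
    (hx : x ∈ Submodule.span ℝ (Δ.v '' (K : Set (Fin d)))) : dotp (uu I i) x = 0 := by
  have : Submodule.span ℝ (Δ.v '' (K : Set (Fin d))) ≤ LinearMap.ker (dotpL (uu I i)) := by
    rw [Submodule.span_le]
    rintro _ ⟨j, hj, rfl⟩
    simp only [Finset.mem_sdiff] at hi
    have hj' : j ∈ K := hj
    simp only [SetLike.mem_coe, LinearMap.mem_ker, dotpL_apply]
    rw [huu I hI hn i hi.1 j (hK hj'), if_neg]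
    rintro rfl; exact hi.2 hj'
  have := this hx
  simpa [dotpL_apply] using this

lemma genericFor_of_dual (Δ : MultiFan n d) (hC : Δ.Complete)
    {uu : Finset (Fin d) → Fin d → (Fin n → ℝ)}
    (huu : Δ.DualBasis uu) {ξ : Fin n → ℝ} (hξ : Δ.GenericDual uu ξ) (K : Finset (Fin d)) :
    Δ.GenericFor K ξ := by
  intro L hL _ hcard hmem
  obtain ⟨I, hI, hLI, hn⟩ := (hC L hL).1
  obtain ⟨i, hi⟩ : (I \ L).Nonempty := by
    rw [Finset.sdiff_nonempty]
    intro h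
    have := Finset.card_le_card h
    omega
  exact hξ I hI hn i (Finset.mem_sdiff.1 hi).1 (Δ.dotp_span_zero huu hI hn hLI hi hmem)

lemma GenericDual.neg {Δ : MultiFan n d} {uu : Finset (Fin d) → Fin d → (Fin n → ℝ)}
    {ξ : Fin n → ℝ} (hξ : Δ.GenericDual uu ξ) : Δ.GenericDual uu (-ξ) := by
  intro I hI hn i hi
  rw [dotp_neg_right]
  exact neg_ne_zero.2 (hξ I hI hn i hi)

lemma inProjCone_iff (Δ : MultiFan n d) {uu : Finset (Fin d) → Fin d → (Fin n → ℝ)}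
    (huu : Δ.DualBasis uu) {I K : Finset (Fin d)} (hI : I ∈ Δ.S) (hn : I.card = n)
    (hK : K ⊆ I) (x : Fin n → ℝ) :
    Δ.InProjCone K I x ↔ ∀ i ∈ I \ K, 0 ≤ dotp (uu I i) x := by
  constructor
  · rintro ⟨a, ha, hx⟩ i hi
    have h0 := Δ.dotp_span_zero huu hI hn hK hi hx
    rw [← dotpL_apply, map_sub, map_sum, sub_eq_zero, dotpL_apply] at h0
    rw [h0, Finset.sum_eq_single i]
    · rw [map_smul, dotpL_apply, huu I hI hn i (Finset.mem_sdiff.1 hi).1 i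
        (Finset.mem_sdiff.1 hi).1]
      simpa using ha i hi
    · intro j hj hji
      rw [map_smul, dotpL_apply, huu I hI hn i (Finset.mem_sdiff.1 hi).1 j
        (Finset.mem_sdiff.1 hj).1, if_neg (Ne.symm hji)]
      simp
    · intro h; exact absurd hi h
  · intro h
    refine ⟨fun j => dotp (uu I j) x, h, ?_⟩
    have e : x - ∑ j ∈ I \ K, dotp (uu I j) x • Δ.v j = ∑ j ∈ K, dotp (uu I j) x • Δ.v j := by
      rw [sub_eq_iff_eq_add, add_comm, Finset.sum_sdiff hK]
      exact Δ.expand huu hI hn x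
    rw [e]
    apply Submodule.sum_mem
    intro j hj
    exact Submodule.smul_mem _ _ (Submodule.subset_span ⟨j, hj, rfl⟩)

open scoped Classical in
/-- The signed count with flip pattern `σ`, for the projected fan at `K`. -/
noncomputable def Dd (Δ : MultiFan n d) (uu : Finset (Fin d) → Fin d → (Fin n → ℝ))
    (ξ : Fin n → ℝ) (K σ : Finset (Fin d)) : ℤ :=
  ∑ I ∈ Δ.S.filter (fun I => I.card = n ∧ K ⊆ I),
    if ∀ i ∈ I \ K, (0 < dotp (uu I i) ξ ↔ i ∈ σ) then (-1 : ℤ) ^ ((I \ K) ∩ σ).card * Δ.w I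
    else 0

lemma Dd_empty (Δ : MultiFan n d) {uu : Finset (Fin d) → Fin d → (Fin n → ℝ)}
    (huu : Δ.DualBasis uu) (ξ : Fin n → ℝ) (K : Finset (Fin d)) :
    Δ.Dd uu ξ K ∅ = Δ.dv K (-ξ) := by
  classical
  unfold Dd dv
  rw [← Finset.sum_filter, Finset.filter_filter]
  apply Finset.sum_congr
  · ext I
    simp only [Finset.mem_filter]
    constructor
    · rintro ⟨hI, ⟨hn, hK⟩, h⟩
      refine ⟨hI, hn, hK, (Δ.inProjCone_iff huu hI hn hK _).2 ?_⟩
      intro i hi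
      have := h i hi
      rw [dotp_neg_right]
      simp at this
      linarith
    · rintro ⟨hI, hn, hK, h⟩
      refine ⟨hI, ⟨hn, hK⟩, ?_⟩
      rw [Δ.inProjCone_iff huu hI hn hK] at h
      intro i hi
      have := h i hi
      rw [dotp_neg_right] at this
      simp; linarith
  · intro I _; simp

lemma Dd_insert_mem (Δ : MultiFan n d) (uu : Finset (Fin d) → Fin d → (Fin n → ℝ))
    (ξ : Fin n → ℝ) (K σ : Finset (Fin d)) (k : Fin d) (hk : k ∈ K) :
    Δ.Dd uu ξ K (insert k σ) = Δ.Dd uu ξ K σ := by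
  classical
  unfold Dd
  apply Finset.sum_congr rfl
  intro I _
  have h1 : (I \ K) ∩ insert k σ = (I \ K) ∩ σ := by
    ext i; simp only [Finset.mem_inter, Finset.mem_sdiff, Finset.mem_insert]
    constructor
    · rintro ⟨⟨a, b⟩, rfl | c⟩
      · exact absurd hk b
      · exact ⟨⟨a, b⟩, c⟩
    · rintro ⟨a, c⟩; exact ⟨a, Or.inr c⟩
  have h2 : (∀ i ∈ I \ K, (0 < dotp (uu I i) ξ ↔ i ∈ insert k σ)) ↔
      (∀ i ∈ I \ K, (0 < dotp (uu I i) ξ ↔ i ∈ σ)) := by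
    apply forall₂_congr
    intro i hi
    have : i ≠ k := by rintro rfl; exact (Finset.mem_sdiff.1 hi).2 hk
    simp [this]
  rw [h1]
  simp only [h2]

lemma Dd_insert (Δ : MultiFan n d) (uu : Finset (Fin d) → Fin d → (Fin n → ℝ))
    (ξ : Fin n → ℝ) (K σ : Finset (Fin d)) (k : Fin d) (hk : k ∉ K) (hkσ : k ∉ σ) :
    Δ.Dd uu ξ K (insert k σ) = Δ.Dd uu ξ K σ - Δ.Dd uu ξ (insert k K) σ := by
  classical
  unfold Dd
  have e : Δ.S.filter (fun I => I.card = n ∧ insert k K ⊆ I) =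
      (Δ.S.filter (fun I => I.card = n ∧ K ⊆ I)).filter (fun I => k ∈ I) := by
    ext I; simp only [Finset.mem_filter, Finset.insert_subset_iff]; tauto
  rw [e, Finset.sum_filter (p := fun I => k ∈ I), ← Finset.sum_sub_distrib]
  apply Finset.sum_congr rfl
  intro I _
  by_cases hkI : k ∈ I
  · rw [if_pos hkI]
    have hs : I \ K = insert k (I \ insert k K) := by
      ext i; simp only [Finset.mem_sdiff, Finset.mem_insert]
      by_cases h : i = k
      · subst h; simp [hkI, hk]
      · simp [h]
    have hnot : k ∉ I \ insert k K := by simp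
    set A := I \ insert k K with hA
    rw [hs]
    have c1 : (insert k A ∩ insert k σ).card = (A ∩ σ).card + 1 := by
      rw [← Finset.insert_inter_distrib, Finset.card_insert_of_notMem]
      simp [hnot]
    have c2 : insert k A ∩ σ = A ∩ σ := by
      rw [Finset.insert_inter_of_notMem hkσ]
    rw [c1, c2]
    simp only [Finset.forall_mem_insert]
    have h2 : (∀ i ∈ A, (0 < dotp (uu I i) ξ ↔ i = k ∨ i ∈ σ)) ↔
        (∀ i ∈ A, (0 < dotp (uu I i) ξ ↔ i ∈ σ)) := by
      apply forall₂_congr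
      intro i hi
      have : i ≠ k := by rintro rfl; exact hnot hi
      simp [this]
    simp only [Finset.mem_insert, h2, true_or, iff_true, hkσ, iff_false]
    by_cases hp : 0 < dotp (uu I k) ξ
    · simp only [hp, true_and, not_true_eq_false, false_and, if_false]
      split_ifs <;> simp [pow_succ]
    · simp only [hp, not_false_eq_true, true_and, false_and, if_false]
      split_ifs <;> simp
  · rw [if_neg hkI, sub_zero]
    have h1 : (I \ K) ∩ insert k σ = (I \ K) ∩ σ := by
      rw [Finset.inter_insert_of_notMem]; simp [hkI]
    have h2 : (∀ i ∈ I \ K, (0 < dotp (uu I i) ξ ↔ i ∈ insert k σ)) ↔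
        (∀ i ∈ I \ K, (0 < dotp (uu I i) ξ ↔ i ∈ σ)) := by
      apply forall₂_congr
      intro i hi
      have : i ≠ k := by rintro rfl; exact hkI (Finset.mem_sdiff.1 hi).1
      simp [this]
    rw [h1]
    simp only [h2]

lemma Dd_indep (Δ : MultiFan n d) (hC : Δ.Complete)
    {uu : Finset (Fin d) → Fin d → (Fin n → ℝ)}
    (huu : Δ.DualBasis uu) {ξ ξ' : Fin n → ℝ} (hξ : Δ.GenericDual uu ξ)
    (hξ' : Δ.GenericDual uu ξ') (σ : Finset (Fin d)) :
    ∀ K, Δ.Dd uu ξ K σ = Δ.Dd uu ξ' K σ := by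
  induction σ using Finset.induction_on with
  | empty =>
    intro K
    by_cases hK : K ∈ Δ.S
    · rw [Δ.Dd_empty huu, Δ.Dd_empty huu]
      exact (hC K hK).2 _ _ (Δ.genericFor_of_dual hC huu hξ.neg K)
        (Δ.genericFor_of_dual hC huu hξ'.neg K)
    · have : ∀ I ∈ Δ.S, ¬ (I.card = n ∧ K ⊆ I) := by
        rintro I hI ⟨_, h⟩; exact hK (Δ.downClosed I hI K h)
      unfold Dd
      rw [Finset.filter_false_of_mem this]; simp
  | insert k σ hk ih =>
    intro K
    by_cases h : k ∈ K
    · rw [Dd_insert_mem _ _ _ _ _ _ h, Dd_insert_mem _ _ _ _ _ _ h, ih]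
    · rw [Dd_insert _ _ _ _ _ _ h hk, Dd_insert _ _ _ _ _ _ h hk, ih, ih]

open scoped Classical in
/-- The set of indices whose (shifted) facet inequality fails at `u`. -/
noncomputable def sg (Δ : MultiFan n d) (c : Fin d → ℝ) (u : Fin n → ℝ) : Finset (Fin d) :=
  Finset.univ.filter (fun i => c i < dotp u (Δ.v i))

lemma mem_sg (Δ : MultiFan n d) (c : Fin d → ℝ) (u : Fin n → ℝ) (i : Fin d) :
    i ∈ Δ.sg c u ↔ c i < dotp u (Δ.v i) := by
  simp [sg]

open scoped Classical in
lemma Dd_sg (Δ : MultiFan n d) {uu : Finset (Fin d) → Fin d → (Fin n → ℝ)}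
    {ξ : Fin n → ℝ} (c : Fin d → ℝ) (u : Fin n → ℝ) :
    Δ.Dd uu ξ ∅ (Δ.sg c u) = ∑ I ∈ Δ.S.filter (fun I => I.card = n),
      if (∀ i ∈ I, (0 < dotp (uu I i) ξ ↔ c i < dotp u (Δ.v i)))
      then (-1 : ℤ) ^ (I.filter fun i => 0 < dotp (uu I i) ξ).card * Δ.w I else 0 := by
  unfold Dd
  simp only [Finset.empty_subset, and_true, Finset.sdiff_empty, mem_sg]
  apply Finset.sum_congr rfl
  intro I _
  split_ifs with h
  · congr 3
    ext i
    simp only [Finset.mem_inter, mem_sg, Finset.mem_filter]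
    constructor
    · rintro ⟨a, b⟩; exact ⟨a, (h i a).2 b⟩
    · rintro ⟨a, b⟩; exact ⟨a, (h i a).1 b⟩
  · rfl

lemma DH_eq_Dd (Δ : MultiFan n d) {uu : Finset (Fin d) → Fin d → (Fin n → ℝ)}
    {ξ : Fin n → ℝ} (hξ : Δ.GenericDual uu ξ) (c c' : Fin d → ℝ) (u : Fin n → ℝ)
    (h : ∀ I ∈ Δ.S, I.card = n → ∀ i ∈ I, (c i ≤ dotp u (Δ.v i) ↔ c' i < dotp u (Δ.v i)) ∧
      (dotp u (Δ.v i) ≤ c i ↔ dotp u (Δ.v i) ≤ c' i)) :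
    Δ.DH c uu ξ u = Δ.Dd uu ξ ∅ (Δ.sg c' u) := by
  classical
  rw [Dd_sg]
  unfold DH
  apply Finset.sum_congr rfl
  intro I hI
  rw [Finset.mem_filter] at hI
  have : (∀ i ∈ I, (0 < dotp (uu I i) ξ ∧ c i ≤ dotp u (Δ.v i)) ∨
                 (dotp (uu I i) ξ < 0 ∧ dotp u (Δ.v i) ≤ c i)) ↔
      (∀ i ∈ I, (0 < dotp (uu I i) ξ ↔ c' i < dotp u (Δ.v i))) := by
    apply forall₂_congr
    intro i hi
    obtain ⟨h1, h2⟩ := h I hI.1 hI.2 i hi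
    rw [h1, h2]
    rcases lt_or_gt_of_ne (hξ I hI.1 hI.2 i hi) with hh | hh
    · simp [hh, not_lt.2 hh.le]
    · simp [hh, not_lt.2 hh.le]
  simp only [this]

lemma support_ineq (Δ : MultiFan n d) {uu : Finset (Fin d) → Fin d → (Fin n → ℝ)}
    (huu : Δ.DualBasis uu) {ξ : Fin n → ℝ} (c : Fin d → ℝ)
    (u : Fin n → ℝ) (h : Δ.Dd uu ξ ∅ (Δ.sg c u) ≠ 0) :
    ∃ I ∈ Δ.S, I.card = n ∧ ∑ i ∈ I, c i * dotp (uu I i) ξ ≤ dotp u ξ := by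
  classical
  rw [Dd_sg] at h
  obtain ⟨I, hI, h1⟩ := Finset.exists_ne_zero_of_sum_ne_zero h
  rw [Finset.mem_filter] at hI
  refine ⟨I, hI.1, hI.2, ?_⟩
  rw [Δ.dotp_expand huu hI.1 hI.2 u ξ]
  apply Finset.sum_le_sum
  intro i hi
  have h2 : ∀ i ∈ I, (0 < dotp (uu I i) ξ ↔ c i < dotp u (Δ.v i)) := by
    by_contra hcon
    exact h1 (if_neg hcon)
  have := h2 i hi
  by_cases hp : 0 < dotp (uu I i) ξ
  · have := this.1 hp
    nlinarith
  · have h3 := not_lt.1 (fun hh => hp (this.2 hh))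
    push Not at hp
    nlinarith

lemma support_bound (Δ : MultiFan n d) (hC : Δ.Complete)
    {uu : Finset (Fin d) → Fin d → (Fin n → ℝ)}
    (huu : Δ.DualBasis uu) {ξ : Fin n → ℝ} (hξ : Δ.GenericDual uu ξ) (c : Fin d → ℝ)
    {ξ' : Fin n → ℝ} (hξ' : Δ.GenericDual uu ξ') :
    ∃ R : ℝ, ∀ u : Fin n → ℝ, Δ.Dd uu ξ ∅ (Δ.sg c u) ≠ 0 → |dotp u ξ'| ≤ R := by
  refine ⟨∑ I ∈ Δ.S, |∑ i ∈ I, c i * dotp (uu I i) ξ'|, ?_⟩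
  intro u hu
  obtain ⟨I, hI, hn, h1⟩ := Δ.support_ineq huu c u
    (ξ := ξ') (by rwa [← Δ.Dd_indep hC huu hξ hξ'])
  obtain ⟨J, hJ, hm, h2⟩ := Δ.support_ineq huu c u
    (ξ := -ξ') (by rwa [← Δ.Dd_indep hC huu hξ hξ'.neg])
  have b : ∀ I ∈ Δ.S, |∑ i ∈ I, c i * dotp (uu I i) ξ'| ≤
      ∑ I ∈ Δ.S, |∑ i ∈ I, c i * dotp (uu I i) ξ'| := fun I hI =>
    Finset.single_le_sum (f := fun I => |∑ i ∈ I, c i * dotp (uu I i) ξ'|)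
      (fun _ _ => abs_nonneg _) hI
  simp only [dotp_neg_right, mul_neg, Finset.sum_neg_distrib] at h2
  have b1 := b I hI
  have b2 := b J hJ
  rw [abs_le] at b1 b2
  rw [abs_le]
  constructor <;> linarith

lemma exists_generic (Δ : MultiFan n d) {uu : Finset (Fin d) → Fin d → (Fin n → ℝ)}
    {ξ : Fin n → ℝ} (hξ : Δ.GenericDual uu ξ) (e : Fin n → ℝ) :
    ∃ t : ℝ, t ≠ 0 ∧ Δ.GenericDual uu (ξ + t • e) := by
  classical
  let B : Finset ℝ := insert 0 ((Δ.S ×ˢ Finset.univ).image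
    (fun p : Finset (Fin d) × Fin d => - dotp (uu p.1 p.2) ξ / dotp (uu p.1 p.2) e))
  obtain ⟨t, ht⟩ := Infinite.exists_notMem_finset B
  refine ⟨t, ?_, ?_⟩
  · rintro rfl; exact ht (Finset.mem_insert_self _ _)
  · intro I hI hn i hi h0
    rw [← dotpL_apply, map_add, map_smul, dotpL_apply, dotpL_apply, smul_eq_mul] at h0
    have h1 := hξ I hI hn i hi
    by_cases he : dotp (uu I i) e = 0
    · rw [he] at h0; simp at h0; exact h1 h0
    · apply ht
      apply Finset.mem_insert_of_mem
      rw [Finset.mem_image]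
      refine ⟨(I, i), by simp [hI], ?_⟩
      field_simp
      linarith

lemma dotp_single (u : Fin n → ℝ) (k : Fin n) : dotp u (Pi.single k 1) = u k := by
  simp [dotp_eq]

lemma support_bounded (Δ : MultiFan n d) (hC : Δ.Complete)
    {uu : Finset (Fin d) → Fin d → (Fin n → ℝ)}
    (huu : Δ.DualBasis uu) {ξ : Fin n → ℝ} (hξ : Δ.GenericDual uu ξ) (c : Fin d → ℝ) :
    ∃ R : ℝ, ∀ u : Fin n → ℝ, Δ.Dd uu ξ ∅ (Δ.sg c u) ≠ 0 → ∀ k, |u k| ≤ R := by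
  have hk : ∀ k : Fin n, ∃ R : ℝ, ∀ u : Fin n → ℝ, Δ.Dd uu ξ ∅ (Δ.sg c u) ≠ 0 → |u k| ≤ R := by
    intro k
    obtain ⟨t, ht, hg⟩ := Δ.exists_generic hξ (Pi.single k 1)
    obtain ⟨R1, h1⟩ := Δ.support_bound hC huu hξ c hξ
    obtain ⟨R2, h2⟩ := Δ.support_bound hC huu hξ c hg
    refine ⟨(R1 + R2) / |t|, ?_⟩
    intro u hu
    have a := h1 u hu
    have b := h2 u hu
    rw [← dotpL_apply, map_add, map_smul, dotpL_apply, dotpL_apply, smul_eq_mul, dotp_single] at b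
    rw [le_div_iff₀ (abs_pos.2 ht), ← abs_mul]
    rw [abs_le] at *
    constructor <;> nlinarith
  choose R hR using hk
  refine ⟨∑ k, |R k|, fun u hu k => (hR k u hu).trans ((le_abs_self _).trans ?_)⟩
  exact Finset.single_le_sum (f := fun k => |R k|) (fun _ _ => abs_nonneg _) (Finset.mem_univ k)

lemma sg_smul (Δ : MultiFan n d) (c : Fin d → ℝ) (u : Fin n → ℝ) {t : ℝ} (ht : 0 < t) :
    Δ.sg (fun i => t * c i) (t • u) = Δ.sg c u := by
  ext i
  rw [mem_sg, mem_sg, dotp_comm, ← dotpL_apply, map_smul, dotpL_apply, dotp_comm, smul_eq_mul]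
  exact mul_lt_mul_iff_right₀ ht

lemma Dd_zero_of_ne (Δ : MultiFan n d) (hC : Δ.Complete)
    {uu : Finset (Fin d) → Fin d → (Fin n → ℝ)}
    (huu : Δ.DualBasis uu) {ξ : Fin n → ℝ} (hξ : Δ.GenericDual uu ξ) (u : Fin n → ℝ)
    (hu : u ≠ 0) : Δ.Dd uu ξ ∅ (Δ.sg 0 u) = 0 := by
  by_contra h
  obtain ⟨R, hR⟩ := Δ.support_bounded hC huu hξ 0
  obtain ⟨k, hk⟩ := Function.ne_iff.1 hu
  simp only [Pi.zero_apply] at hk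
  have hk' := abs_pos.2 hk
  set t : ℝ := (|R| + 1) / |u k| with ht
  have htp : 0 < t := by positivity
  have := hR (t • u) (by
    have e := Δ.sg_smul 0 u htp
    have e0 : (fun i => t * (0 : Fin d → ℝ) i) = 0 := by ext; simp
    rw [e0] at e
    rwa [e]) k
  rw [Pi.smul_apply, smul_eq_mul, abs_mul, abs_of_pos htp, ht, div_mul_cancel₀ _ hk'.ne'] at this
  linarith [le_abs_self R]

lemma Dd_zero_zero (Δ : MultiFan n d) (hC : Δ.Complete)
    {uu : Finset (Fin d) → Fin d → (Fin n → ℝ)}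
    (huu : Δ.DualBasis uu) {ξ : Fin n → ℝ} (hξ : Δ.GenericDual uu ξ)
    (deg : ℤ) (hdeg : ∀ x : Fin n → ℝ, Δ.Generic x → Δ.dv ∅ x = deg) :
    Δ.Dd uu ξ ∅ (Δ.sg 0 0) = deg := by
  have : Δ.sg 0 0 = ∅ := by
    ext i; rw [mem_sg]; simp [dotp]
  rw [this, Δ.Dd_empty huu]
  exact hdeg _ (Δ.genericFor_of_dual hC huu hξ.neg ∅)

end MultiFan

end Part1

section Part2

open scoped Classical in
lemma summable_half (s b : ℝ) (hs : 0 < s) (hb : b ≠ 0) :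
    Summable (fun y : ℤ => if (0 < b ↔ 0 < y) then Real.exp (-s * (b * y)) else 0) := by
  have hr0 : 0 ≤ Real.exp (-(s * |b|)) := (Real.exp_pos _).le
  have hr1 : Real.exp (-(s * |b|)) < 1 := by
    rw [Real.exp_lt_one_iff]
    have := abs_pos.2 hb
    nlinarith
  have hg := summable_geometric_of_lt_one hr0 hr1
  have hmaj : Summable (fun y : ℤ => Real.exp (-(s * |b|)) ^ y.natAbs) := by
    apply Summable.of_nat_of_neg
    · simpa using hg
    · simpa using hg
  refine Summable.of_nonneg_of_le ?_ ?_ hmaj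
  · intro y; split_ifs
    · exact (Real.exp_pos _).le
    · exact le_rfl
  · intro y
    split_ifs with h
    · rw [← Real.exp_nat_mul]
      apply Real.exp_le_exp.2
      rw [Nat.cast_natAbs, Int.cast_abs]
      have : b * (y : ℝ) = |b| * |(y : ℝ)| := by
        rw [← abs_mul]
        symm
        apply abs_of_nonneg
        by_cases hp : 0 < b
        · have := h.1 hp
          have : (0 : ℝ) < y := by exact_mod_cast this
          positivity
        · have h2 : y ≤ 0 := not_lt.1 (fun hh => hp (h.2 hh))
          have : (y : ℝ) ≤ 0 := by exact_mod_cast h2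
          nlinarith [not_lt.1 hp]
      rw [this]
      nlinarith
    · positivity

lemma summable_pi_comp {ι L : Type*} [Fintype ι] (y : L → ι → ℤ)
    (inj : Function.Injective y) (φ : ι → ℤ → ℝ) (h0 : ∀ i k, 0 ≤ φ i k)
    (hφ : ∀ i, Summable (φ i)) : Summable (fun u : L => ∏ i, φ i (y u i)) := by
  classical
  apply summable_of_sum_le (c := ∏ i, ∑' k, φ i k)
  · intro u; exact Finset.prod_nonneg (fun i _ => h0 _ _)
  · intro F
    let t : ι → Finset ℤ := fun i => F.image (fun u => y u i)
    calc ∑ u ∈ F, ∏ i, φ i (y u i) = ∑ x ∈ F.image y, ∏ i, φ i (x i) := by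
          rw [Finset.sum_image]; intro a _ b _ h; exact inj h
      _ ≤ ∑ x ∈ Fintype.piFinset t, ∏ i, φ i (x i) := by
          apply Finset.sum_le_sum_of_subset_of_nonneg
          · intro x hx
            obtain ⟨u, hu, rfl⟩ := Finset.mem_image.1 hx
            rw [Fintype.mem_piFinset]
            intro i
            exact Finset.mem_image_of_mem (fun u => y u i) hu
          · intro x _ _; exact Finset.prod_nonneg (fun i _ => h0 _ _)
      _ = ∏ i, ∑ k ∈ t i, φ i k := (Finset.prod_univ_sum _ _).symm
      _ ≤ ∏ i, ∑' k, φ i k := by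
          apply Finset.prod_le_prod
          · intro i _; exact Finset.sum_nonneg (fun k _ => h0 _ _)
          · intro i _; exact (hφ i).sum_le_tsum _ (fun k _ => h0 _ _)

lemma analytic_todd (β : ℝ) (hβ : β ≠ 0) :
    ∃ G : ℝ → ℝ, AnalyticAt ℝ G 0 ∧ ∀ s : ℝ, s ≠ 0 → s / (1 - Real.exp (-s * β)) = G s := by
  let f : ℝ → ℝ := fun s => 1 - Real.exp (-s * β)
  have hf : AnalyticAt ℝ f 0 := by
    refine analyticAt_const.sub (AnalyticAt.rexp ?_)
    exact (analyticAt_id.neg).mul analyticAt_const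
  have hd : AnalyticAt ℝ (dslope f 0) 0 := by
    obtain ⟨p, hp⟩ := hf
    exact ⟨_, hp.has_fpower_series_dslope_fslope⟩
  have hder : HasDerivAt f β 0 := by
    have h1 : HasDerivAt (fun s : ℝ => -s * β) (-1 * β) 0 :=
      (hasDerivAt_id (0 : ℝ)).neg.mul_const β
    have := (h1.exp).const_sub 1
    simpa [f] using this
  have h0 : dslope f 0 0 ≠ 0 := by
    rw [dslope_same, hder.deriv]; exact hβ
  refine ⟨(dslope f 0)⁻¹, hd.inv h0, ?_⟩
  intro s hs
  rw [Pi.inv_apply, dslope_of_ne _ hs, slope_def_field]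
  simp [f]

section cone

variable {ι L : Type*} [Fintype ι] [AddCommGroup L]

/-- half-open cone, truncated to one period in the directions of `J` -/
def coneP (y : ι → L →+ ℤ) (b : ι → ℝ) (m : ℤ) (J : Finset ι) (u : L) : Prop :=
  ∀ i, (0 < b i ↔ 0 < y i u) ∧ (i ∈ J → -m < y i u ∧ y i u ≤ m)

open scoped Classical in
noncomputable def coneF (y : ι → L →+ ℤ) (b : ι → ℝ) (m : ℤ) (J : Finset ι) (s : ℝ) (u : L) : ℝ :=
  if coneP y b m J u then Real.exp (-s * ∑ i, b i * y i u) else 0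

lemma coneF_summable_empty (y : ι → L →+ ℤ) (inj : Function.Injective (fun u i => y i u))
    (b : ι → ℝ) (hb : ∀ i, b i ≠ 0) (m : ℤ) (s : ℝ) (hs : 0 < s) :
    Summable (coneF y b m ∅ s) := by
  classical
  have := summable_pi_comp (fun u i => y i u) inj
    (fun i (k : ℤ) => if (0 < b i ↔ 0 < k) then Real.exp (-s * (b i * k)) else 0)
    (fun i k => by
      split_ifs
      · exact (Real.exp_pos _).le
      · exact le_rfl)
    (fun i => summable_half s (b i) hs (hb i))
  refine this.congr ?_
  intro u
  unfold coneF coneP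
  by_cases h : ∀ i, (0 < b i ↔ 0 < y i u)
  · rw [if_pos (by intro i; exact ⟨h i, by simp⟩), Finset.mul_sum, Real.exp_sum]
    apply Finset.prod_congr rfl
    intro i _
    rw [if_pos (h i)]
  · rw [if_neg (by intro h'; exact h (fun i => (h' i).1))]
    obtain ⟨i, hi⟩ := not_forall.1 h
    apply Finset.prod_eq_zero (Finset.mem_univ i)
    rw [if_neg hi]

lemma coneF_summable (y : ι → L →+ ℤ) (inj : Function.Injective (fun u i => y i u))
    (b : ι → ℝ) (hb : ∀ i, b i ≠ 0) (m : ℤ) (J : Finset ι) (s : ℝ) (hs : 0 < s) :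
    Summable (coneF y b m J s) := by
  classical
  refine Summable.of_nonneg_of_le ?_ ?_ (coneF_summable_empty y inj b hb m s hs)
  · intro u; unfold coneF; split_ifs
    · exact (Real.exp_pos _).le
    · exact le_rfl
  · intro u; unfold coneF
    by_cases h : coneP y b m J u
    · rw [if_pos h, if_pos]
      intro i; exact ⟨(h i).1, by simp⟩
    · rw [if_neg h]; split_ifs
      · exact (Real.exp_pos _).le
      · exact le_rfl

lemma coneF_finite (y : ι → L →+ ℤ) (inj : Function.Injective (fun u i => y i u))
    (b : ι → ℝ) (m : ℤ) : {u | coneP y b m Finset.univ u}.Finite := by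
  classical
  have : ((Fintype.piFinset (fun _ : ι => Finset.Icc (-m) m) : Finset (ι → ℤ)) : Set (ι → ℤ)).Finite :=
    Finset.finite_toSet _
  refine (this.preimage (f := fun u i => y i u) inj.injOn).subset ?_
  intro u hu
  simp only [Set.mem_preimage, Finset.mem_coe, Fintype.mem_piFinset, Finset.mem_Icc]
  intro i
  have := (hu i).2 (Finset.mem_univ i)
  exact ⟨this.1.le, this.2⟩

lemma coneF_step [DecidableEq ι] (y : ι → L →+ ℤ) (inj : Function.Injective (fun u i => y i u))
    (b : ι → ℝ) (hb : ∀ i, b i ≠ 0) (m : ℤ) (hm : 0 < m) (z : ι → L)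
    (hz : ∀ i j, y j (z i) = if i = j then m else 0) (J : Finset ι) (k : ι) (hk : k ∉ J)
    (s : ℝ) (hs : 0 < s) :
    (1 - Real.exp (-s * (m * |b k|))) * ∑' u, coneF y b m J s u =
      ∑' u, coneF y b m (insert k J) s u := by
  let z' : L := if 0 < b k then z k else - z k
  have hzk : y k z' = if 0 < b k then m else -m := by
    simp only [z']; split_ifs <;> simp [hz]
  have hzj : ∀ j, j ≠ k → y j z' = 0 := by
    intro j hj
    simp only [z']; split_ifs <;> simp [hz, hj.symm]
  have hbz : ∑ i, b i * (y i z' : ℝ) = m * |b k| := by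
    rw [Finset.sum_eq_single k]
    · rw [hzk]; split_ifs with h
      · rw [abs_of_pos h]; ring
      · rw [abs_of_nonpos (not_lt.1 h)]; push_cast; ring
    · intro j _ hj; rw [hzj j hj]; simp
    · simp
  have pt : ∀ u, coneF y b m J s u = coneF y b m (insert k J) s u +
      Real.exp (-s * (m * |b k|)) * coneF y b m J s (u - z') := by
    intro u
    have hexp : Real.exp (-s * ∑ i, b i * (y i u : ℝ)) =
        Real.exp (-s * (m * |b k|)) * Real.exp (-s * ∑ i, b i * (y i (u - z') : ℝ)) := by
      rw [← Real.exp_add, ← hbz]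
      congr 1
      rw [← mul_add, ← Finset.sum_add_distrib]
      congr 1
      apply Finset.sum_congr rfl
      intro i _
      rw [map_sub]; push_cast; ring
    have hA : coneP y b m (insert k J) u ↔ coneP y b m J u ∧ (-m < y k u ∧ y k u ≤ m) := by
      unfold coneP
      constructor
      · intro h
        refine ⟨fun i => ⟨(h i).1, fun hi => (h i).2 (Finset.mem_insert_of_mem hi)⟩,
          (h k).2 (Finset.mem_insert_self _ _)⟩
      · rintro ⟨h, h2⟩ i
        refine ⟨(h i).1, fun hi => ?_⟩
        rcases Finset.mem_insert.1 hi with rfl | hi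
        · exact h2
        · exact (h i).2 hi
    have hB : coneP y b m J (u - z') ↔ coneP y b m J u ∧ ¬ (-m < y k u ∧ y k u ≤ m) := by
      unfold coneP
      constructor
      · intro h
        have hkk := (h k).1
        rw [map_sub, hzk] at hkk
        refine ⟨fun i => ?_, ?_⟩
        · by_cases hik : i = k
          · subst hik
            refine ⟨?_, fun hi => absurd hi hk⟩
            split_ifs at hkk with hp
            · simp only [hp, true_iff] at hkk ⊢; omega
            · simp only [hp, false_iff] at hkk ⊢; omega
          · have := h i
            rwa [map_sub, hzj i hik, sub_zero] at this
        · split_ifs at hkk with hp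
          · simp only [hp, true_iff] at hkk; omega
          · simp only [hp, false_iff] at hkk; omega
      · rintro ⟨h, h2⟩ i
        by_cases hik : i = k
        · subst hik
          refine ⟨?_, fun hi => absurd hi hk⟩
          have hkk := (h i).1
          rw [map_sub, hzk]
          split_ifs with hp
          · simp only [hp, true_iff] at hkk ⊢; omega
          · simp only [hp, false_iff] at hkk ⊢; omega
        · rw [map_sub, hzj i hik, sub_zero]
          exact h i
    unfold coneF
    by_cases hJ : coneP y b m J u
    · by_cases h2 : (-m < y k u ∧ y k u ≤ m)
      · rw [if_pos hJ, if_pos (hA.2 ⟨hJ, h2⟩), if_neg (fun h => (hB.1 h).2 h2)]; simp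
      · rw [if_pos hJ, if_neg (fun h => h2 (hA.1 h).2), if_pos (hB.2 ⟨hJ, h2⟩), hexp]; simp
    · rw [if_neg hJ, if_neg (fun h => hJ (hA.1 h).1), if_neg (fun h => hJ (hB.1 h).1)]; simp
  have hsum := coneF_summable y inj b hb m J s hs
  have hshift : ∑' u, coneF y b m J s (u - z') = ∑' u, coneF y b m J s u :=
    (Equiv.subRight z').tsum_eq (coneF y b m J s)
  have hsum' : Summable (fun u => coneF y b m J s (u - z')) :=
    (Equiv.subRight z').summable_iff.2 hsum
  have : ∑' u, coneF y b m J s u = ∑' u, coneF y b m (insert k J) s u +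
      Real.exp (-s * (m * |b k|)) * ∑' u, coneF y b m J s u := by
    conv_lhs => rw [tsum_congr pt]
    rw [Summable.tsum_add (coneF_summable y inj b hb m _ s hs) (hsum'.mul_left _), tsum_mul_left,
      hshift]
  linarith

lemma coneF_prod [DecidableEq ι] (y : ι → L →+ ℤ) (inj : Function.Injective (fun u i => y i u))
    (b : ι → ℝ) (hb : ∀ i, b i ≠ 0) (m : ℤ) (hm : 0 < m) (z : ι → L)
    (hz : ∀ i j, y j (z i) = if i = j then m else 0) (s : ℝ) (hs : 0 < s) (J : Finset ι) :
    (∏ k ∈ J, (1 - Real.exp (-s * (m * |b k|)))) * ∑' u, coneF y b m ∅ s u =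
      ∑' u, coneF y b m J s u := by
  induction J using Finset.induction_on with
  | empty => simp
  | insert k J hk ih =>
    rw [Finset.prod_insert hk, mul_assoc, ih, coneF_step y inj b hb m hm z hz J k hk s hs]

theorem cone_gf [DecidableEq ι] (y : ι → L →+ ℤ) (inj : Function.Injective (fun u i => y i u))
    (b : ι → ℝ) (hb : ∀ i, b i ≠ 0) (m : ℤ) (hm : 0 < m) (z : ι → L)
    (hz : ∀ i j, y j (z i) = if i = j then m else 0) :
    ∃ G : ℝ → ℝ, AnalyticAt ℝ G 0 ∧ ∀ s : ℝ, 0 < s →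
      s ^ (Fintype.card ι) * ∑' u, coneF y b m ∅ s u = G s := by
  have hβ : ∀ k, (m : ℝ) * |b k| ≠ 0 := fun k =>
    mul_ne_zero (by exact_mod_cast hm.ne') (abs_ne_zero.2 (hb k))
  choose T hT hT2 using fun k => analytic_todd ((m : ℝ) * |b k|) (hβ k)
  have hfin := coneF_finite y inj b m
  refine ⟨fun s => (∏ k, T k s) * ∑ u ∈ hfin.toFinset, Real.exp (-s * ∑ i, b i * y i u), ?_, ?_⟩
  · apply AnalyticAt.mul
    · exact Finset.analyticAt_fun_prod _ (fun k _ => hT k)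
    · apply Finset.analyticAt_fun_sum
      intro u _
      exact AnalyticAt.rexp ((analyticAt_id.neg).mul analyticAt_const)
  · intro s hs
    have h1 := coneF_prod y inj b hb m hm z hz s hs Finset.univ
    have h2 : ∑' u, coneF y b m Finset.univ s u =
        ∑ u ∈ hfin.toFinset, Real.exp (-s * ∑ i, b i * y i u) := by
      rw [tsum_eq_sum (s := hfin.toFinset)]
      · apply Finset.sum_congr rfl
        intro u hu
        unfold coneF
        rw [if_pos]
        simpa using hu
      · intro u hu
        unfold coneF
        rw [if_neg]
        simpa using hu
    simp only
    rw [← h2, ← h1, ← mul_assoc, ← Finset.prod_mul_distrib]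
    congr 1
    rw [Fintype.card, ← Finset.prod_const]
    apply Finset.prod_congr rfl
    intro k _
    rw [← hT2 k s hs.ne', div_mul_cancel₀]
    have : Real.exp (-s * (m * |b k|)) < 1 := by
      rw [Real.exp_lt_one_iff]
      have h3 : 0 < (m : ℝ) * |b k| := mul_pos (by exact_mod_cast hm) (abs_pos.2 (hb k))
      nlinarith
    linarith

end cone

end Part2

section Part3

lemma poly_of_gf {κ L : Type*} (Q : Finset κ) (coef a : κ → ℝ) (G : κ → ℝ → ℝ)
    (hG : ∀ I ∈ Q, AnalyticAt ℝ (G I) 0) (n : ℕ) :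
    ∃ p : Polynomial ℝ, p.natDegree ≤ n ∧ ∀ (ν : ℝ) (F : Finset L) (wt h : L → ℝ),
      (∀ s : ℝ, 0 < s → s ^ n * ∑ u ∈ F, wt u * Real.exp (-s * h u) =
        ∑ I ∈ Q, coef I * Real.exp (-s * (ν * a I)) * G I s) →
      ∑ u ∈ F, wt u = p.eval ν := by
  refine ⟨∑ I ∈ Q, ∑ k ∈ Finset.range (n + 1), Polynomial.C (coef I * (n.choose k : ℝ) *
    (- a I) ^ k * iteratedDeriv (n - k) (G I) 0 / (n.factorial : ℝ)) * Polynomial.X ^ k, ?_, ?_⟩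
  · apply Polynomial.natDegree_sum_le_of_forall_le
    intro I _
    apply Polynomial.natDegree_sum_le_of_forall_le
    intro k hk
    refine (Polynomial.natDegree_C_mul_X_pow_le _ _).trans ?_
    have := Finset.mem_range.1 hk
    omega
  · intro ν F wt h H
    have hL0 : AnalyticAt ℝ (fun s : ℝ => ∑ u ∈ F, wt u * Real.exp (-s * h u)) 0 := by
      apply Finset.analyticAt_fun_sum
      intro u _
      exact analyticAt_const.mul (AnalyticAt.rexp ((analyticAt_id.neg).mul analyticAt_const))
    have hP : AnalyticAt ℝ (fun s : ℝ => s ^ n) 0 := analyticAt_id.pow n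
    have hL : AnalyticAt ℝ ((fun s : ℝ => s ^ n) *
        (fun s : ℝ => ∑ u ∈ F, wt u * Real.exp (-s * h u))) 0 := hP.mul hL0
    have hE : ∀ I, AnalyticAt ℝ (fun s : ℝ => Real.exp ((-(ν * a I)) * s)) 0 := by
      intro I
      exact AnalyticAt.rexp (analyticAt_const.mul analyticAt_id)
    have hR1 : ∀ I ∈ Q, AnalyticAt ℝ ((fun s : ℝ => Real.exp ((-(ν * a I)) * s)) * G I) 0 :=
      fun I hI => (hE I).mul (hG I hI)
    have hR2 : ∀ I ∈ Q, AnalyticAt ℝ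
        (fun s => coef I * ((fun s : ℝ => Real.exp ((-(ν * a I)) * s)) * G I) s) 0 :=
      fun I hI => analyticAt_const.mul (hR1 I hI)
    have hR : AnalyticAt ℝ (fun s => ∑ I ∈ Q,
        coef I * ((fun s : ℝ => Real.exp ((-(ν * a I)) * s)) * G I) s) 0 :=
      Finset.analyticAt_fun_sum _ hR2
    have hfreq : ∃ᶠ s in nhdsWithin (0 : ℝ) {0}ᶜ, ((fun s : ℝ => s ^ n) *
        (fun s : ℝ => ∑ u ∈ F, wt u * Real.exp (-s * h u))) s = (fun s => ∑ I ∈ Q,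
        coef I * ((fun s : ℝ => Real.exp ((-(ν * a I)) * s)) * G I) s) s := by
      have h1 : ∃ᶠ s in nhdsWithin (0 : ℝ) (Set.Ioi 0), ((fun s : ℝ => s ^ n) *
        (fun s : ℝ => ∑ u ∈ F, wt u * Real.exp (-s * h u))) s = (fun s => ∑ I ∈ Q,
        coef I * ((fun s : ℝ => Real.exp ((-(ν * a I)) * s)) * G I) s) s := by
        apply Filter.Eventually.frequently
        filter_upwards [self_mem_nhdsWithin] with s hs
        have := H s hs
        simp only [Pi.mul_apply]
        rw [this]
        apply Finset.sum_congr rfl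
        intro I _
        rw [mul_assoc]
        congr 3
        ring
      refine h1.filter_mono (nhdsWithin_mono _ ?_)
      intro s hs; exact ne_of_gt hs
    have hev := (hL.frequently_eq_iff_eventually_eq hR).1 hfreq
    have hD := Filter.EventuallyEq.iteratedDeriv_eq n hev
    rw [iteratedDeriv_mul hP.contDiffAt hL0.contDiffAt,
      iteratedDeriv_fun_sum (fun I hI => (hR2 I hI).contDiffAt)] at hD
    rw [Finset.sum_eq_single n] at hD
    rotate_left
    · intro k _ hk
      rw [iteratedDeriv_fun_pow_zero, if_neg hk]; simp
    · simp
    simp only [iteratedDeriv_fun_pow_zero, Nat.choose_self, Nat.sub_self, iteratedDeriv_zero] at hD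
    have hf : (n.factorial : ℝ) ≠ 0 := by exact_mod_cast n.factorial_ne_zero
    have hS : (n.factorial : ℝ) * ∑ u ∈ F, wt u = ∑ I ∈ Q, ∑ k ∈ Finset.range (n + 1),
        (coef I * (n.choose k : ℝ) * (- a I) ^ k * iteratedDeriv (n - k) (G I) 0) * ν ^ k := by
      have e1 : (n.factorial : ℝ) * ∑ u ∈ F, wt u = ∑ I ∈ Q, iteratedDeriv n
          (fun s => coef I * ((fun s : ℝ => Real.exp ((-(ν * a I)) * s)) * G I) s) 0 := by
        rw [← hD]; simp
      rw [e1]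
      apply Finset.sum_congr rfl
      intro I hI
      rw [iteratedDeriv_const_mul_field, iteratedDeriv_mul (hE I).contDiffAt (hG I hI).contDiffAt,
        Finset.mul_sum]
      apply Finset.sum_congr rfl
      intro k _
      rw [iteratedDeriv_exp_const_mul]
      simp only [mul_zero, Real.exp_zero, mul_one]
      rw [show -(ν * a I) = ν * (- a I) by ring, mul_pow]
      ring
    rw [Polynomial.eval_finsetSum]
    simp only [Polynomial.eval_finsetSum, Polynomial.eval_mul, Polynomial.eval_C,
      Polynomial.eval_pow, Polynomial.eval_X]
    rw [← mul_right_inj' hf, hS, Finset.mul_sum]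
    apply Finset.sum_congr rfl
    intro I _
    rw [Finset.mul_sum]
    apply Finset.sum_congr rfl
    intro k _
    field_simp

lemma coeff_of_tendsto (p : Polynomial ℝ) (n : ℕ) (hp : p.natDegree ≤ n) (l : ℝ)
    (h : Filter.Tendsto (fun ν : ℕ => p.eval (ν : ℝ) / (ν : ℝ) ^ n) Filter.atTop (nhds l)) :
    p.coeff n = l := by
  refine tendsto_nhds_unique ?_ h
  have e : ∀ᶠ ν : ℕ in Filter.atTop, ∑ k ∈ Finset.range (n + 1),
      p.coeff k * ((ν : ℝ) ^ (n - k))⁻¹ = p.eval (ν : ℝ) / (ν : ℝ) ^ n := by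
    filter_upwards [Filter.eventually_gt_atTop 0] with ν hν
    rw [Polynomial.eval_eq_sum_range' (Nat.lt_succ_of_le hp), Finset.sum_div]
    apply Finset.sum_congr rfl
    intro k hk
    have : k ≤ n := by have := Finset.mem_range.1 hk; omega
    have hν' : (ν : ℝ) ≠ 0 := by positivity
    rw [mul_div_assoc]
    congr 1
    rw [eq_div_iff (by positivity)]
    conv_lhs => rw [← Nat.sub_add_cancel this, pow_add]
    simp only [Nat.add_sub_cancel]
    field_simp
  refine Filter.Tendsto.congr' e ?_
  have : p.coeff n = ∑ k ∈ Finset.range (n + 1), if k = n then p.coeff n else 0 := by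
    simp
  rw [this]
  apply tendsto_finsetSum
  intro k hk
  split_ifs with hkn
  · subst hkn; simp
  · have h1 : n - k ≠ 0 := by have := Finset.mem_range.1 hk; omega
    have : Filter.Tendsto (fun ν : ℕ => ((ν : ℝ) ^ (n - k))⁻¹) Filter.atTop (nhds 0) :=
      tendsto_inv_atTop_zero.comp
        ((Filter.tendsto_pow_atTop h1).comp tendsto_natCast_atTop_atTop)
    simpa using this.const_mul (p.coeff k)

end Part3

section Part4

variable {n d : ℕ}

/-- cast of an integer vector -/
def zc (u : Fin n → ℤ) : Fin n → ℝ := fun k => (u k : ℝ)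

namespace LMultiFan

/-- the integral pairing with the ray `v i` -/
def yy (Δ : LMultiFan n d) (i : Fin d) : (Fin n → ℤ) →+ ℤ where
  toFun u := ∑ k, u k * Δ.v i k
  map_zero' := by simp
  map_add' u u' := by simp [add_mul, Finset.sum_add_distrib]

lemma yy_cast (Δ : LMultiFan n d) (i : Fin d) (u : Fin n → ℤ) :
    ((Δ.yy i u : ℤ) : ℝ) = dotp (zc u) (Δ.toMF.v i) := by
  simp [yy, dotp, zc, toMF]

lemma exists_z (Δ : LMultiFan n d) {I : Finset (Fin d)} (hI : I ∈ Δ.S) (hn : I.card = n) :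
    ∃ m : ℤ, 0 < m ∧ ∃ z : {x // x ∈ I} → (Fin n → ℤ),
      ∀ i j : {x // x ∈ I}, Δ.yy j.1 (z i) = if i = j then m else 0 := by
  have hcard : Fintype.card {x // x ∈ I} = Fintype.card (Fin n) := by simp [hn]
  let e : {x // x ∈ I} ≃ Fin n := Fintype.equivOfCardEq hcard
  let A : Matrix (Fin n) (Fin n) ℤ := fun j k => Δ.v (e.symm j).1 k
  have hdet : A.det ≠ 0 := by
    intro h0
    have hli : LinearIndependent ℝ (A.map (Int.cast : ℤ → ℝ)).row := by
      have := (Δ.indep I hI).comp e.symm e.symm.injective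
      exact this
    rw [Matrix.linearIndependent_rows_iff_isUnit, Matrix.isUnit_iff_isUnit_det] at hli
    have h1 : (A.map (Int.cast : ℤ → ℝ)).det = ((A.det : ℤ) : ℝ) :=
      (RingHom.map_det (Int.castRingHom ℝ) A).symm
    rw [h1, h0] at hli
    simp at hli
  refine ⟨A.det * A.det, mul_self_pos.2 hdet, fun i k => A.det * A.adjugate k (e i), ?_⟩
  intro i j
  have h := congrFun (congrFun (Matrix.mul_adjugate A) (e j)) (e i)
  rw [Matrix.mul_apply] at h
  simp only [A, Equiv.symm_apply_apply, Matrix.smul_apply, Matrix.one_apply, smul_eq_mul] at h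
  simp only [yy, AddMonoidHom.coe_mk, ZeroHom.coe_mk]
  have e1 : ∀ k, A.det * A.adjugate k (e i) * Δ.v j.1 k =
      A.det * (Δ.v j.1 k * A.adjugate k (e i)) := fun k => by ring
  rw [Finset.sum_congr rfl (fun k _ => e1 k), ← Finset.mul_sum]
  refine (congrArg (fun t => A.det * t) h).trans ?_
  by_cases hij : i = j
  · subst hij; simp [A]
  · have : e j ≠ e i := fun hh => hij (e.injective hh).symm
    simp [hij, this]

lemma yy_inj (Δ : LMultiFan n d) {uu : Finset (Fin d) → Fin d → (Fin n → ℝ)}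
    (huu : Δ.toMF.DualBasis uu) {I : Finset (Fin d)} (hI : I ∈ Δ.S) (hn : I.card = n) :
    Function.Injective (fun (u : Fin n → ℤ) (i : {x // x ∈ I}) => Δ.yy i.1 u) := by
  intro u u' h
  ext k
  have key : ∀ w : Fin n → ℤ, ((w k : ℤ) : ℝ) =
      ∑ i ∈ I, dotp (uu I i) (Pi.single k 1) * ((Δ.yy i w : ℤ) : ℝ) := by
    intro w
    have := Δ.toMF.dotp_expand huu hI hn (zc w) (Pi.single k 1)
    rw [MultiFan.dotp_single] at this
    simp only [yy_cast]
    exact this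
  have : ((u k : ℤ) : ℝ) = ((u' k : ℤ) : ℝ) := by
    rw [key u, key u']
    apply Finset.sum_congr rfl
    intro i hi
    have := congrFun h ⟨i, hi⟩
    simp only at this
    rw [this]
  exact_mod_cast this

lemma vertex (Δ : LMultiFan n d) {c : Fin d → ℝ} {uu : Finset (Fin d) → Fin d → (Fin n → ℝ)}
    (huu : Δ.toMF.DualBasis uu) (hlat : Δ.LatticeVertices c uu)
    {I : Finset (Fin d)} (hI : I ∈ Δ.S) (hn : I.card = n) :
    ∃ t : Fin n → ℤ, ∀ i ∈ I, ((Δ.yy i t : ℤ) : ℝ) = c i := by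
  choose t ht using hlat I hI hn
  refine ⟨t, ?_⟩
  intro j hj
  rw [yy_cast]
  have e : zc t = ∑ i ∈ I, c i • uu I i := by
    ext k; simp [zc, ← ht k]
  rw [e, dotp_comm, ← dotpL_apply, map_sum, Finset.sum_eq_single j]
  · rw [map_smul, dotpL_apply, dotp_comm, huu I hI hn j hj j hj]; simp
  · intro i hi hij
    rw [map_smul, dotpL_apply, dotp_comm, huu I hI hn i hi j hj, if_neg hij]; simp
  · intro h; exact absurd hj h

/-- lattice-point values of the half-open Duistermaat-Heckman function -/
noncomputable def gz (Δ : LMultiFan n d) (uu : Finset (Fin d) → Fin d → (Fin n → ℝ))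
    (ξ : Fin n → ℝ) (c : Fin d → ℝ) (u : Fin n → ℤ) : ℤ :=
  Δ.toMF.Dd uu ξ ∅ (Δ.toMF.sg c (zc u))

lemma gz_support (Δ : LMultiFan n d) (hC : Δ.toMF.Complete)
    {uu : Finset (Fin d) → Fin d → (Fin n → ℝ)}
    (huu : Δ.toMF.DualBasis uu) {ξ : Fin n → ℝ} (hξ : Δ.toMF.GenericDual uu ξ) (c : Fin d → ℝ) :
    ∃ F : Finset (Fin n → ℤ), ∀ u, Δ.gz uu ξ c u ≠ 0 → u ∈ F := by
  obtain ⟨R, hR⟩ := Δ.toMF.support_bounded hC huu hξ c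
  refine ⟨Fintype.piFinset (fun _ => Finset.Icc (-⌈R⌉) ⌈R⌉), ?_⟩
  intro u hu
  rw [Fintype.mem_piFinset]
  intro k
  have h := hR _ hu k
  rw [abs_le] at h
  have h2 := Int.le_ceil R
  rw [Finset.mem_Icc]
  have a1 : ((-⌈R⌉ : ℤ) : ℝ) ≤ u k := by push_cast; linarith [h.1, show zc u k = u k from rfl]
  have a2 : ((u k : ℤ) : ℝ) ≤ ⌈R⌉ := by linarith [h.2, show zc u k = u k from rfl]
  exact ⟨by exact_mod_cast a1, by exact_mod_cast a2⟩

lemma sharpP_eq (Δ : LMultiFan n d) 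
    {c : Fin d → ℝ} {uu : Finset (Fin d) → Fin d → (Fin n → ℝ)}
    (huu : Δ.toMF.DualBasis uu) {ξ : Fin n → ℝ} (hξ : Δ.toMF.GenericDual uu ξ)
    (hlat : Δ.LatticeVertices c uu) (ν : ℕ) (F : Finset (Fin n → ℤ))
    (hF : ∀ u, Δ.gz uu ξ (fun i => (ν : ℝ) * c i) u ≠ 0 → u ∈ F) :
    Δ.sharpP (fun i => (ν : ℝ) * c i) uu ξ = ∑ u ∈ F, Δ.gz uu ξ (fun i => (ν : ℝ) * c i) u := by
  have e : ∀ u : Fin n → ℤ, Δ.toMF.DH (fun i => (ν : ℝ) * c i + 1/2) uu ξ (fun k => (u k : ℝ)) =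
      Δ.gz uu ξ (fun i => (ν : ℝ) * c i) u := by
    intro u
    apply Δ.toMF.DH_eq_Dd hξ
    intro I hI hn i hi
    obtain ⟨t, ht⟩ := Δ.vertex huu hlat hI hn
    change ((ν : ℝ) * c i + 1/2 ≤ dotp (zc u) (Δ.toMF.v i) ↔ _ < dotp (zc u) (Δ.toMF.v i)) ∧
      (dotp (zc u) (Δ.toMF.v i) ≤ _ ↔ dotp (zc u) (Δ.toMF.v i) ≤ _)
    rw [← yy_cast, ← ht i hi]
    generalize Δ.yy i u = a
    have : ((ν : ℝ) * (Δ.yy i t : ℤ)) = (((ν : ℤ) * Δ.yy i t : ℤ) : ℝ) := by push_cast; rfl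
    rw [this]
    generalize (ν : ℤ) * Δ.yy i t = q
    refine ⟨⟨fun h => by linarith, fun h => ?_⟩, ⟨fun h => ?_, fun h => by linarith⟩⟩
    · have h' : q < a := by exact_mod_cast h
      have : ((q + 1 : ℤ) : ℝ) ≤ a := by exact_mod_cast h'
      push_cast at this; linarith
    · by_contra hc
      push Not at hc
      have h' : q < a := by exact_mod_cast hc
      have : ((q + 1 : ℤ) : ℝ) ≤ a := by exact_mod_cast h'
      push_cast at this; linarith
  unfold sharpP
  rw [finsum_congr e]
  apply finsum_eq_sum_of_support_subset
  intro u hu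
  exact hF u hu

theorem exists_poly (Δ : LMultiFan n d) 
    {c : Fin d → ℝ} {uu : Finset (Fin d) → Fin d → (Fin n → ℝ)}
    (huu : Δ.toMF.DualBasis uu) {ξ : Fin n → ℝ} (hξ : Δ.toMF.GenericDual uu ξ)
    (hlat : Δ.LatticeVertices c uu) :
    ∃ p : Polynomial ℝ, p.natDegree ≤ n ∧ ∀ (ν : ℕ) (F : Finset (Fin n → ℤ)),
      (∀ u, Δ.gz uu ξ (fun i => (ν : ℝ) * c i) u ≠ 0 → u ∈ F) →
      ∑ u ∈ F, (Δ.gz uu ξ (fun i => (ν : ℝ) * c i) u : ℝ) = p.eval (ν : ℝ) := by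
  classical
  let Q := Δ.toMF.S.filter (fun I => I.card = n)
  have hQ : ∀ I : {I // I ∈ Q}, I.1 ∈ Δ.S ∧ I.1.card = n := fun I => Finset.mem_filter.1 I.2
  choose t ht using fun I : {I // I ∈ Q} => Δ.vertex huu hlat (hQ I).1 (hQ I).2
  choose m hm z hz using fun I : {I // I ∈ Q} => Δ.exists_z (hQ I).1 (hQ I).2
  let b : (I : {I // I ∈ Q}) → {x // x ∈ I.1} → ℝ := fun I i => dotp (uu I.1 i.1) ξ
  have hb : ∀ I i, b I i ≠ 0 := fun I i => hξ I.1 (hQ I).1 (hQ I).2 i.1 i.2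
  have hinj := fun I : {I // I ∈ Q} => Δ.yy_inj huu (hQ I).1 (hQ I).2
  choose G hG hGs using fun I : {I // I ∈ Q} =>
    cone_gf (fun i : {x // x ∈ I.1} => Δ.yy i.1) (hinj I) (b I) (hb I) (m I) (hm I) (z I) (hz I)
  let coef : {I // I ∈ Q} → ℤ := fun I =>
    (-1 : ℤ) ^ (I.1.filter fun i => 0 < dotp (uu I.1 i) ξ).card * Δ.w I.1
  obtain ⟨p, hp, hpe⟩ := poly_of_gf (L := Fin n → ℤ) Finset.univ (fun I => (coef I : ℝ))
    (fun I => dotp (zc (t I)) ξ) G (fun I _ => hG I) n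
  refine ⟨p, hp, ?_⟩
  intro ν F hF
  apply hpe (ν : ℝ) F _ (fun u => dotp (zc u) ξ)
  intro s hs
  have hdot : ∀ (I : {I // I ∈ Q}) (u : Fin n → ℤ),
      dotp (zc u) ξ = ∑ i : {x // x ∈ I.1}, b I i * (Δ.yy i.1 u : ℤ) := by
    intro I u
    rw [Δ.toMF.dotp_expand huu (hQ I).1 (hQ I).2 (zc u) ξ, ← Finset.sum_coe_sort I.1]
    simp only [b, yy_cast]
  have pt : ∀ u : Fin n → ℤ, (Δ.gz uu ξ (fun i => (ν : ℝ) * c i) u : ℝ) *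
      Real.exp (-s * dotp (zc u) ξ) = ∑ I : {I // I ∈ Q},
        (coef I : ℝ) * Real.exp (-s * (ν * dotp (zc (t I)) ξ)) *
          coneF (fun i : {x // x ∈ I.1} => Δ.yy i.1) (b I) (m I) ∅ s (u - ν • t I) := by
    intro u
    unfold gz
    rw [MultiFan.Dd_sg, Int.cast_sum, Finset.sum_mul, ← Finset.sum_coe_sort Q]
    apply Finset.sum_congr rfl
    intro I _
    have hy : ∀ i : {x // x ∈ I.1}, ((Δ.yy i.1 (u - ν • t I) : ℤ) : ℝ) =
        (Δ.yy i.1 u : ℤ) - ν * c i.1 := by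
      intro i
      rw [map_sub, map_nsmul, ← ht I i.1 i.2]
      simp
    have hiff : (∀ i ∈ I.1, (0 < dotp (uu I.1 i) ξ ↔ (ν : ℝ) * c i < dotp (zc u) (Δ.toMF.v i))) ↔
        coneP (fun i : {x // x ∈ I.1} => Δ.yy i.1) (b I) (m I) ∅ (u - ν • t I) := by
      unfold coneP
      simp only [Finset.notMem_empty, false_imp_iff, and_true, Subtype.forall]
      apply forall₂_congr
      intro i hi
      have h1 := hy ⟨i, hi⟩
      have h2 : (0 < Δ.yy i (u - ν • t I)) ↔ (ν : ℝ) * c i < dotp (zc u) (Δ.toMF.v i) := by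
        rw [← yy_cast, ← Int.cast_pos (R := ℝ), h1, sub_pos]
      rw [h2]
    unfold coneF
    by_cases hc : coneP (fun i : {x // x ∈ I.1} => Δ.yy i.1) (b I) (m I) ∅ (u - ν • t I)
    · rw [if_pos (hiff.2 hc), if_pos hc, mul_assoc (coef I : ℝ), ← Real.exp_add]
      congr 2
      rw [← hdot I (u - ν • t I)]
      have : zc (u - ν • t I) = zc u - (ν : ℝ) • zc (t I) := by
        ext k; simp [zc]
      have e2 : dotp (zc u - (ν : ℝ) • zc (t I)) ξ =
          dotp (zc u) ξ - ν * dotp (zc (t I)) ξ := by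
        rw [dotp_comm, ← dotpL_apply ξ, map_sub, map_smul, dotpL_apply, dotpL_apply,
          dotp_comm ξ, dotp_comm ξ, smul_eq_mul]
      rw [this, e2]
      ring
    · rw [if_neg (fun h => hc (hiff.1 h)), if_neg hc]; simp
  have hsum : ∀ I : {I // I ∈ Q}, Summable (fun u : Fin n → ℤ =>
      coneF (fun i : {x // x ∈ I.1} => Δ.yy i.1) (b I) (m I) ∅ s (u - ν • t I)) := fun I =>
    (Equiv.subRight (ν • t I)).summable_iff.2
      (coneF_summable _ (hinj I) (b I) (hb I) (m I) ∅ s hs)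
  have hshift : ∀ I : {I // I ∈ Q}, ∑' u : Fin n → ℤ,
      coneF (fun i : {x // x ∈ I.1} => Δ.yy i.1) (b I) (m I) ∅ s (u - ν • t I) =
      ∑' u : Fin n → ℤ, coneF (fun i : {x // x ∈ I.1} => Δ.yy i.1) (b I) (m I) ∅ s u := fun I =>
    (Equiv.subRight (ν • t I)).tsum_eq
      (coneF (fun i : {x // x ∈ I.1} => Δ.yy i.1) (b I) (m I) ∅ s)
  have e1 : ∑ u ∈ F, (Δ.gz uu ξ (fun i => (ν : ℝ) * c i) u : ℝ) *
      Real.exp (-s * dotp (zc u) ξ) = ∑' u, (Δ.gz uu ξ (fun i => (ν : ℝ) * c i) u : ℝ) *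
      Real.exp (-s * dotp (zc u) ξ) := by
    symm
    apply tsum_eq_sum
    intro u hu
    have : Δ.gz uu ξ (fun i => (ν : ℝ) * c i) u = 0 := by
      by_contra h; exact hu (hF u h)
    rw [this]; simp
  rw [e1, tsum_congr pt, Summable.tsum_finsetSum (fun I _ => (hsum I).mul_left _), Finset.mul_sum]
  apply Finset.sum_congr rfl
  intro I _
  rw [tsum_mul_left, hshift, ← hGs I s hs]
  have : Fintype.card {x // x ∈ I.1} = n := by simp [(hQ I).2]
  rw [this]
  ring

end LMultiFan

end Part4

section Part5

variable {n d : ℕ}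

open MeasureTheory Filter Topology
open scoped Pointwise

lemma hyperplane_null (v : Fin n → ℝ) (hv : v ≠ 0) (a : ℝ) :
    volume {u : Fin n → ℝ | dotp u v = a} = 0 := by
  by_cases hne : ∃ u0 : Fin n → ℝ, dotp u0 v = a
  · obtain ⟨u0, h0⟩ := hne
    have hk : LinearMap.ker (dotpL v) ≠ ⊤ := by
      intro h
      have h1 : v ∈ LinearMap.ker (dotpL v) := by rw [h]; trivial
      rw [LinearMap.mem_ker, dotpL_apply, dotp_eq, dotProduct_self_eq_zero] at h1
      exact hv h1
    have hs : AffineSubspace.mk' u0 (LinearMap.ker (dotpL v)) ≠ ⊤ := by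
      intro h
      apply hk
      rw [← AffineSubspace.direction_mk' u0 (LinearMap.ker (dotpL v)), h,
        AffineSubspace.direction_top]
    have := Measure.addHaar_affineSubspace (volume : Measure (Fin n → ℝ)) _ hs
    refine measure_mono_null ?_ this
    intro u hu
    rw [Set.mem_ofPred_eq] at hu
    rw [SetLike.mem_coe, AffineSubspace.mem_mk', vsub_eq_sub, LinearMap.mem_ker, map_sub,
      dotpL_apply, dotpL_apply, dotp_comm, hu, dotp_comm, h0, sub_self]
  · have : {u : Fin n → ℝ | dotp u v = a} = ∅ := by
      ext u; simp only [Set.mem_ofPred_eq, Set.mem_empty_iff_false, iff_false]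
      exact fun h => hne ⟨u, h⟩
    rw [this, measure_empty]

lemma dotp_continuous (v : Fin n → ℝ) : Continuous (fun u : Fin n → ℝ => dotp u v) := by
  unfold dotp; fun_prop

namespace MultiFan

/-- The union of the bounding hyperplanes. -/
def walls (Δ : MultiFan n d) (c : Fin d → ℝ) : Set (Fin n → ℝ) :=
  {u | ∃ i, Δ.v i ≠ 0 ∧ dotp u (Δ.v i) = c i}

lemma walls_null (Δ : MultiFan n d) (c : Fin d → ℝ) : volume (Δ.walls c) = 0 := by
  have : Δ.walls c ⊆ ⋃ i : {i // Δ.v i ≠ 0}, {u | dotp u (Δ.v i.1) = c i.1} := by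
    rintro u ⟨i, hi, hu⟩
    exact Set.mem_iUnion.2 ⟨⟨i, hi⟩, hu⟩
  exact measure_mono_null this (measure_iUnion_null fun i => hyperplane_null _ i.2 _)

lemma sg_eventually (Δ : MultiFan n d) (c : Fin d → ℝ) (u : Fin n → ℝ) (hu : u ∉ Δ.walls c) :
    ∀ᶠ u' in 𝓝 u, Δ.sg c u' = Δ.sg c u := by
  have : ∀ i, ∀ᶠ u' in 𝓝 u, (c i < dotp u' (Δ.v i) ↔ c i < dotp u (Δ.v i)) := by
    intro i
    by_cases hv : Δ.v i = 0
    · refine Eventually.of_forall fun u' => ?_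
      rw [hv]; simp [dotp]
    · have hne : dotp u (Δ.v i) ≠ c i := fun h => hu ⟨i, hv, h⟩
      have hc := (dotp_continuous (Δ.v i)).continuousAt (x := u)
      rcases lt_or_gt_of_ne hne with h | h
      · filter_upwards [hc.eventually_lt_const h] with u' hu'
        exact ⟨fun h' => absurd hu' (not_lt.2 h'.le), fun h' => absurd h (not_lt.2 h'.le)⟩
      · filter_upwards [hc.eventually_const_lt h] with u' hu'
        exact ⟨fun _ => h, fun _ => hu'⟩
  filter_upwards [eventually_all.2 this] with u' hu'
  ext i; rw [mem_sg, mem_sg]; exact hu' i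

lemma frontier_null (Δ : MultiFan n d) (c : Fin d → ℝ) (σ : Finset (Fin d)) :
    volume (frontier {u | Δ.sg c u = σ}) = 0 := by
  refine measure_mono_null ?_ (Δ.walls_null c)
  intro u hu
  by_contra hw
  have h := Δ.sg_eventually c u hw
  rw [frontier_eq_closure_inter_closure, Set.mem_inter_iff, mem_closure_iff_frequently,
    mem_closure_iff_frequently] at hu
  obtain ⟨u1, h1, e1⟩ := (hu.1.and_eventually h).exists
  obtain ⟨u2, h2, e2⟩ := (hu.2.and_eventually h).exists
  exact h2 (e2.trans (e1.symm.trans h1))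

lemma cell_measurable (Δ : MultiFan n d) (c : Fin d → ℝ) (σ : Finset (Fin d)) :
    MeasurableSet {u | Δ.sg c u = σ} := by
  have : {u | Δ.sg c u = σ} = ⋂ i, {u | c i < dotp u (Δ.v i) ↔ i ∈ σ} := by
    ext u
    simp only [Set.mem_ofPred_eq, Set.mem_iInter, Finset.ext_iff, mem_sg]
  rw [this]
  refine MeasurableSet.iInter fun i => ?_
  have hm : MeasurableSet {u : Fin n → ℝ | c i < dotp u (Δ.v i)} :=
    (isOpen_lt continuous_const (dotp_continuous _)).measurableSet
  by_cases hi : i ∈ σ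
  · simpa only [hi, iff_true] using hm
  · simp only [hi, iff_false]
    exact hm.compl

lemma cell_bounded (Δ : MultiFan n d) (hC : Δ.Complete)
    {uu : Finset (Fin d) → Fin d → (Fin n → ℝ)}
    (huu : Δ.DualBasis uu) {ξ : Fin n → ℝ} (hξ : Δ.GenericDual uu ξ) (c : Fin d → ℝ)
    (σ : Finset (Fin d)) (hσ : Δ.Dd uu ξ ∅ σ ≠ 0) :
    Bornology.IsBounded {u | Δ.sg c u = σ} := by
  obtain ⟨R, hR⟩ := Δ.support_bounded hC huu hξ c
  rw [isBounded_iff_forall_norm_le]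
  refine ⟨|R|, fun u hu => ?_⟩
  rw [pi_norm_le_iff_of_nonneg (abs_nonneg R)]
  intro k
  have hu' : Δ.sg c u = σ := hu
  exact (hR u (by rw [hu']; exact hσ) k).trans (le_abs_self R)

lemma integral_DH (Δ : MultiFan n d) (hC : Δ.Complete)
    {uu : Finset (Fin d) → Fin d → (Fin n → ℝ)}
    (huu : Δ.DualBasis uu) {ξ : Fin n → ℝ} (hξ : Δ.GenericDual uu ξ) (c : Fin d → ℝ) :
    (∫ u : Fin n → ℝ, (Δ.DH c uu ξ u : ℝ)) =
      ∑ σ : Finset (Fin d), (Δ.Dd uu ξ ∅ σ : ℝ) * volume.real {u | Δ.sg c u = σ} := by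
  classical
  have h1 : (∫ u : Fin n → ℝ, (Δ.DH c uu ξ u : ℝ)) =
      ∫ u : Fin n → ℝ, ∑ σ : Finset (Fin d),
        Set.indicator {u | Δ.sg c u = σ} (fun _ => (Δ.Dd uu ξ ∅ σ : ℝ)) u := by
    apply integral_congr_ae
    have hae : ∀ᵐ u ∂(volume : Measure (Fin n → ℝ)), u ∉ Δ.walls c :=
      measure_eq_zero_iff_ae_notMem.1 (Δ.walls_null c)
    filter_upwards [hae] with u hu
    have e : Δ.DH c uu ξ u = Δ.Dd uu ξ ∅ (Δ.sg c u) := by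
      apply Δ.DH_eq_Dd hξ
      intro I hI hn i hi
      have hv : Δ.v i ≠ 0 := (Δ.indep I hI).ne_zero ⟨i, hi⟩
      have hne : dotp u (Δ.v i) ≠ c i := fun h => hu ⟨i, hv, h⟩
      exact ⟨⟨fun h => lt_of_le_of_ne h hne.symm, le_of_lt⟩, Iff.rfl⟩
    rw [e, Finset.sum_eq_single (Δ.sg c u)]
    · simp
    · intro σ _ hσ
      rw [Set.indicator_of_notMem]
      exact fun h => hσ (h : Δ.sg c u = σ).symm
    · simp
  rw [h1, integral_finsetSum]
  · refine Finset.sum_congr rfl fun σ _ => ?_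
    rw [integral_indicator_const _ (Δ.cell_measurable c σ), smul_eq_mul, mul_comm]
  · intro σ _
    by_cases hσ : Δ.Dd uu ξ ∅ σ = 0
    · simp [hσ]
    · rw [integrable_indicator_iff (Δ.cell_measurable c σ)]
      exact integrableOn_const (Δ.cell_bounded hC huu hξ c σ hσ).measure_lt_top.ne

end MultiFan

lemma card_lattice (s : Set (Fin n → ℝ)) (ν : ℕ) (hν : 0 < ν) :
    Nat.card ↑(s ∩ (ν : ℝ)⁻¹ • (Submodule.span ℤ (Set.range (Pi.basisFun ℝ (Fin n))) :
      Set (Fin n → ℝ))) = Nat.card {u : Fin n → ℤ // (ν : ℝ)⁻¹ • zc u ∈ s} := by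
  symm
  have hν' : (ν : ℝ)⁻¹ ≠ 0 := by positivity
  refine Nat.card_congr (Equiv.ofBijective (fun u => ⟨(ν : ℝ)⁻¹ • zc u.1, u.2, ?_⟩) ⟨?_, ?_⟩)
  · refine Set.smul_mem_smul_set ?_
    rw [SetLike.mem_coe, Module.Basis.mem_span_iff_repr_mem]
    intro k
    simp [zc]
  · rintro ⟨u, hu⟩ ⟨u', hu'⟩ h
    have h1 : (ν : ℝ)⁻¹ • zc u = (ν : ℝ)⁻¹ • zc u' := congrArg Subtype.val h
    have h2 := smul_right_injective _ hν' h1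
    apply Subtype.ext
    ext k
    have := congrFun h2 k
    simpa [zc] using this
  · rintro ⟨x, hx, y, hy, rfl⟩
    rw [SetLike.mem_coe, Module.Basis.mem_span_iff_repr_mem] at hy
    choose u hu using hy
    have : zc u = y := by
      ext k
      have := hu k
      simpa [zc] using this
    refine ⟨⟨u, ?_⟩, ?_⟩
    · rw [this]; exact hx
    · apply Subtype.ext; simp [this]

namespace LMultiFan

lemma sum_gz (Δ : LMultiFan n d) (c : Fin d → ℝ) (uu : Finset (Fin d) → Fin d → (Fin n → ℝ))
    (ξ : Fin n → ℝ) (ν : ℕ) (hν : 0 < ν) (F : Finset (Fin n → ℤ))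
    (hF : ∀ u, Δ.gz uu ξ (fun i => (ν : ℝ) * c i) u ≠ 0 → u ∈ F) :
    ∑ u ∈ F, (Δ.gz uu ξ (fun i => (ν : ℝ) * c i) u : ℝ) =
      ∑ σ : Finset (Fin d), (Δ.toMF.Dd uu ξ ∅ σ : ℝ) *
        (Nat.card {u : Fin n → ℤ // (ν : ℝ)⁻¹ • zc u ∈ {u' | Δ.toMF.sg c u' = σ}} : ℝ) := by
  classical
  have hν' : (0 : ℝ) < ν := by positivity
  have e : ∀ u : Fin n → ℤ, Δ.toMF.sg (fun i => (ν : ℝ) * c i) (zc u) =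
      Δ.toMF.sg c ((ν : ℝ)⁻¹ • zc u) := by
    intro u
    rw [← Δ.toMF.sg_smul c ((ν : ℝ)⁻¹ • zc u) hν', smul_inv_smul₀ hν'.ne']
  rw [← Finset.sum_fiberwise F (fun u => Δ.toMF.sg c ((ν : ℝ)⁻¹ • zc u))]
  refine Finset.sum_congr rfl fun σ _ => ?_
  have h1 : ∀ u ∈ F.filter (fun u => Δ.toMF.sg c ((ν : ℝ)⁻¹ • zc u) = σ),
      (Δ.gz uu ξ (fun i => (ν : ℝ) * c i) u : ℝ) = (Δ.toMF.Dd uu ξ ∅ σ : ℝ) := by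
    intro u hu
    rw [gz, e u, (Finset.mem_filter.1 hu).2]
  rw [Finset.sum_congr rfl h1, Finset.sum_const, nsmul_eq_mul, mul_comm]
  by_cases hσ : Δ.toMF.Dd uu ξ ∅ σ = 0
  · simp [hσ]
  · congr 2
    rw [← Nat.card_eq_finsetCard]
    refine Nat.card_congr (Equiv.subtypeEquivRight fun u => ?_)
    rw [Finset.mem_filter]
    refine ⟨fun h => h.2, fun h => ⟨hF u ?_, h⟩⟩
    have h' : Δ.toMF.sg c ((ν : ℝ)⁻¹ • zc u) = σ := h
    rw [gz, e u, h']
    exact hσ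

lemma tendsto_gz (Δ : LMultiFan n d) (hC : Δ.toMF.Complete)
    {c : Fin d → ℝ} {uu : Finset (Fin d) → Fin d → (Fin n → ℝ)}
    (huu : Δ.toMF.DualBasis uu) {ξ : Fin n → ℝ} (hξ : Δ.toMF.GenericDual uu ξ) :
    Tendsto (fun ν : ℕ => (∑ σ : Finset (Fin d), (Δ.toMF.Dd uu ξ ∅ σ : ℝ) *
        (Nat.card {u : Fin n → ℤ // (ν : ℝ)⁻¹ • zc u ∈ {u' | Δ.toMF.sg c u' = σ}} : ℝ)) /
          (ν : ℝ) ^ n) atTop (𝓝 (∫ u : Fin n → ℝ, (Δ.toMF.DH c uu ξ u : ℝ))) := by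
  rw [Δ.toMF.integral_DH hC huu hξ c]
  simp only [Finset.sum_div, mul_div_assoc]
  refine tendsto_finsetSum _ fun σ _ => ?_
  by_cases hσ : Δ.toMF.Dd uu ξ ∅ σ = 0
  · simp [hσ]
  · refine Tendsto.const_mul _ ?_
    have h := tendsto_card_div_pow_atTop_volume {u | Δ.toMF.sg c u = σ}
      (Δ.toMF.cell_bounded hC huu hξ c σ hσ) (Δ.toMF.cell_measurable c σ)
      (Δ.toMF.frontier_null c σ)
    refine h.congr' ?_
    filter_upwards [eventually_gt_atTop 0] with ν hν
    rw [card_lattice _ ν hν, Fintype.card_fin]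
    rfl

end LMultiFan

end Part5

/-- **Theorem 7.2 (3)**: for a simple lattice multi-polytope `P`, the coefficient of `νⁿ`
in the Ehrhart polynomial `♯(νP)` is `vol(P) = ∫_{V^*} DH_P dV^*` and the constant term is
`deg(Δ)`. -/
theorem stmt11 (n d : ℕ) (Δ : LMultiFan n d) (hC : Δ.toMF.Complete)
    (c : Fin d → ℝ) (uu : Finset (Fin d) → Fin d → (Fin n → ℝ))
    (huu : Δ.toMF.DualBasis uu) (ξ : Fin n → ℝ) (hξ : Δ.toMF.GenericDual uu ξ)
    (hlat : Δ.LatticeVertices c uu)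
    (deg : ℤ) (hdeg : ∀ x : Fin n → ℝ, Δ.toMF.Generic x → Δ.toMF.dv ∅ x = deg) :
    ∃ p : Polynomial ℝ, p.natDegree ≤ n ∧
      (∀ ν : ℕ, 0 < ν → (Δ.sharpP (fun i => (ν : ℝ) * c i) uu ξ : ℝ) = p.eval (ν : ℝ)) ∧
      p.coeff n = (∫ u : Fin n → ℝ, (Δ.toMF.DH c uu ξ u : ℝ)) ∧
      p.coeff 0 = (deg : ℝ) := by
  classical
  obtain ⟨p, hp, hpe⟩ := Δ.exists_poly huu hξ hlat
  refine ⟨p, hp, ?_, ?_, ?_⟩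
  · intro ν _
    obtain ⟨F, hF⟩ := Δ.gz_support hC huu hξ (fun i => (ν : ℝ) * c i)
    rw [Δ.sharpP_eq huu hξ hlat ν F hF, Int.cast_sum]
    exact hpe ν F hF
  · apply coeff_of_tendsto p n hp
    refine (Δ.tendsto_gz hC huu hξ).congr' ?_
    filter_upwards [Filter.eventually_gt_atTop 0] with ν hν
    obtain ⟨F, hF⟩ := Δ.gz_support hC huu hξ (fun i => (ν : ℝ) * c i)
    rw [← hpe ν F hF, Δ.sum_gz c uu ξ ν hν F hF]
    rfl
  · have h0 : (fun i => ((0 : ℕ) : ℝ) * c i) = (0 : Fin d → ℝ) := by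
      ext i; simp
    have hz : ∀ u : Fin n → ℤ, u ≠ 0 → Δ.gz uu ξ 0 u = 0 := by
      intro u hu
      apply Δ.toMF.Dd_zero_of_ne hC huu hξ
      intro h
      apply hu
      ext k
      have := congrFun h k
      simpa [zc] using this
    have hzz : zc (0 : Fin n → ℤ) = 0 := by ext k; simp [zc]
    have h := hpe 0 {0} (by
      intro u hu
      rw [h0] at hu
      rw [Finset.mem_singleton]
      by_contra hne
      exact hu (hz u hne))
    rw [Finset.sum_singleton, h0, LMultiFan.gz, hzz,
      Δ.toMF.Dd_zero_zero hC huu hξ deg hdeg] at h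
    rw [Polynomial.coeff_zero_eq_eval_zero, h]
    simp
end
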